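/- arXiv:1705.03367 — 2 statements merged into one kernel-verified Lean document; each statement's English description precedes it below -/
import Mathlib

section
/- Let Γ be a basic finite-dimensional algebra over a field, Π a maximal projective-injective direct summand of Γ, and k ≥ 0. (a) The subcategory gen_{k-1}(Π) of Γ-mod contains a k-tilting module if and only if domdim Γ ≥ k, and when it exists, any basic k-tilting module in gen_{k-1}(Π) is isomorphic to the Π-special k-tilting module T_k. (b) The subcategory cogen^{k-1}(Π) contains a k-cotilting module if and only if domdim Γ ≥ k, and when it exists, any basic k-cotilting module in cogen^{k-1}(Π) is isomorphic to the Π-special k-cotilting module C^k. -/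
/-!
Formalization of definitions from "Special tilting modules for algebras with positive
dominant dimension" (Pressland–Sauter), together with one of its statements.
-/

open CategoryTheory

noncomputable section
namespace PS

variable {R : Type} [Ring R]

/-- `N` is (isomorphic to) a direct summand of `M`. -/
def IsSummand (N M : ModuleCat.{0} R) : Prop :=
  ∃ (ι : N →ₗ[R] M) (π : M →ₗ[R] N), π ∘ₗ ι = LinearMap.id

/-- `M` lies in `add X`: it is a direct summand of a finite direct sum of copies of `X`. -/
def MemAdd (X M : ModuleCat.{0} R) : Prop :=
  ∃ n : ℕ, IsSummand M (ModuleCat.of R (Fin n → X))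

/-- `M` is projective-injective. -/
def ProjInj (M : ModuleCat.{0} R) : Prop :=
  Module.Projective R M ∧ Module.Injective R M

/-- The regular left module. -/
def reg (R : Type) [Ring R] : ModuleCat.{0} R := ModuleCat.of R R

/-- A module is basic if no nonzero module `X` has `X ⊕ X` as a direct summand of it
(equivalently, for finite length modules, its indecomposable direct summands are pairwise
non-isomorphic). -/
def IsBasic (M : ModuleCat.{0} R) : Prop :=
  ∀ X : ModuleCat.{0} R, IsSummand (ModuleCat.of R (X × X)) M → Subsingleton X

/-- `P` is a maximal projective-injective direct summand of the regular module. -/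
def IsMaxProjInjSummand (P : ModuleCat.{0} R) : Prop :=
  IsSummand P (reg R) ∧ ProjInj P ∧
    ∀ Q : ModuleCat.{0} R, IsSummand Q (reg R) → ProjInj Q → MemAdd P Q

/-- The data `Y 0 → Y 1 → ⋯ → Y n` forms an exact sequence
`0 → Y 0 → Y 1 → ⋯ → Y n → 0` (with `n ≥ 1` maps; terms beyond `Y n` are ignored). -/
def IsExactSeq (n : ℕ) (Y : ℕ → ModuleCat.{0} R) (f : ∀ i, Y i →ₗ[R] Y (i+1)) : Prop :=
  Function.Injective (f 0) ∧ Function.Surjective (f (n-1)) ∧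
    ∀ i, i + 2 ≤ n → Function.Exact (f i) (f (i+1))

/-- The algebra `R` has dominant dimension at least `k`: the regular module has an
injective resolution whose first `k` terms are projective-injective. -/
def DomdimGE (R : Type) [Ring R] (k : ℕ) : Prop :=
  ∃ (Y : ℕ → ModuleCat.{0} R) (g : reg R →ₗ[R] Y 0) (f : ∀ i, Y i →ₗ[R] Y (i+1)),
    Function.Injective g ∧ Function.Exact g (f 0) ∧
    (∀ i, Function.Exact (f i) (f (i+1))) ∧
    (∀ i, Module.Injective R (Y i)) ∧ (∀ i, i < k → Module.Projective R (Y i))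

/-- `domdim R = d`. -/
def DomdimEq (R : Type) [Ring R] (d : ℕ) : Prop :=
  DomdimGE R d ∧ ¬ DomdimGE R (d+1)

/-- The Ext group `Ext^j(M, N)` in the category of `R`-modules. -/
def ext (M N : ModuleCat.{0} R) (j : ℕ) : Type :=
  ((Ext ℤ (ModuleCat.{0} R) j).obj (Opposite.op M)).obj N

/-- `Ext^j(M, N) = 0` (for a single `j`). -/
def ExtZero (M N : ModuleCat.{0} R) (j : ℕ) : Prop := Subsingleton (ext M N j)

/-- `Ext^j(M, N) = 0` for all `j ≥ 1`. -/
def ExtVanishing (M N : ModuleCat.{0} R) : Prop :=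
  ∀ j : ℕ, 1 ≤ j → ExtZero M N j

/-- Projective dimension at most `k`. -/
def PdimLE (k : ℕ) (M : ModuleCat.{0} R) : Prop :=
  ∃ (Y : ℕ → ModuleCat.{0} R) (f : ∀ i, Y i →ₗ[R] Y (i+1)),
    IsExactSeq (k+1) Y f ∧ (∀ i, i ≤ k → Module.Projective R (Y i)) ∧ Y (k+1) = M

/-- Injective dimension at most `k`. -/
def IdimLE (k : ℕ) (M : ModuleCat.{0} R) : Prop :=
  ∃ (Y : ℕ → ModuleCat.{0} R) (f : ∀ i, Y i →ₗ[R] Y (i+1)),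
    IsExactSeq (k+1) Y f ∧ (∀ i, 1 ≤ i → i ≤ k+1 → Module.Injective R (Y i)) ∧ Y 0 = M

/-- `T` is a `k`-tilting module. -/
def IsTilting (k : ℕ) (T : ModuleCat.{0} R) : Prop :=
  Module.Finite R T ∧ PdimLE k T ∧ ExtVanishing T T ∧
    ∃ (Y : ℕ → ModuleCat.{0} R) (f : ∀ i, Y i →ₗ[R] Y (i+1)),
      IsExactSeq (k+1) Y f ∧ Y 0 = reg R ∧ ∀ i, 1 ≤ i → i ≤ k+1 → MemAdd T (Y i)

/-- `T` is a `P`-special `k`-tilting module: it is `k`-tilting, and there is a coresolution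
`0 → R → t_0 → ⋯ → t_k → 0` with all `t_j ∈ add T` and `t_j ∈ add P` for `j ≤ k-1`. -/
def IsSpecialTilting (P : ModuleCat.{0} R) (k : ℕ) (T : ModuleCat.{0} R) : Prop :=
  IsTilting k T ∧
    ∃ (Y : ℕ → ModuleCat.{0} R) (f : ∀ i, Y i →ₗ[R] Y (i+1)),
      IsExactSeq (k+1) Y f ∧ Y 0 = reg R ∧ (∀ i, 1 ≤ i → i ≤ k+1 → MemAdd T (Y i)) ∧
        (∀ i, 1 ≤ i → i ≤ k → MemAdd P (Y i))

/-- `M ∈ gen_k(X)`: there is an exact sequence `X^k → ⋯ → X^0 → M → 0` with `X^i ∈ add X`. -/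
def MemGen (k : ℕ) (X M : ModuleCat.{0} R) : Prop :=
  ∃ (Y : ℕ → ModuleCat.{0} R) (f : ∀ i, Y i →ₗ[R] Y (i+1)),
    (∀ i, i ≤ k → MemAdd X (Y i)) ∧ Y (k+1) = M ∧
    Function.Surjective (f k) ∧ ∀ i, i < k → Function.Exact (f i) (f (i+1))

/-- `M ∈ cogen^k(X)`: there is an exact sequence `0 → M → X_0 → ⋯ → X_k` with `X_i ∈ add X`. -/
def MemCogen (k : ℕ) (X M : ModuleCat.{0} R) : Prop :=
  ∃ (Y : ℕ → ModuleCat.{0} R) (f : ∀ i, Y i →ₗ[R] Y (i+1)),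
    (∀ i, 1 ≤ i → i ≤ k+1 → MemAdd X (Y i)) ∧ Y 0 = M ∧
    Function.Injective (f 0) ∧ ∀ i, i < k → Function.Exact (f i) (f (i+1))

/-- `M ∈ gen_{k-1}(X)`, where `gen_{-1}(X)` is the whole module category. -/
def MemGenShift : ℕ → ModuleCat.{0} R → ModuleCat.{0} R → Prop
  | 0, _X, _M => True
  | (k+1), X, M => MemGen k X M

/-- `M ∈ cogen^{k-1}(X)`, where `cogen^{-1}(X)` is the whole module category. -/
def MemCogenShift : ℕ → ModuleCat.{0} R → ModuleCat.{0} R → Prop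
  | 0, _X, _M => True
  | (k+1), X, M => MemCogen k X M

/-- Global dimension at most `n` (on finitely generated modules). -/
def GldimLE (R : Type) [Ring R] (n : ℕ) : Prop :=
  ∀ M : ModuleCat.{0} R, Module.Finite R M → PdimLE n M

/-- Global dimension exactly `n`. -/
def GldimEq (R : Type) [Ring R] (n : ℕ) : Prop :=
  GldimLE R n ∧ ∀ m : ℕ, GldimLE R m → n ≤ m

section Duality

variable (K : Type) [Field K]

section DualDefs
variable (S M : Type) [Semiring S] [AddCommGroup M] [Module K M]

/-- The action of `s : S` as a `K`-linear endomorphism. -/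
def actMap [Module S M] [SMulCommClass S K M] (s : S) : M →ₗ[K] M where
  toFun m := s • m
  map_add' := smul_add s
  map_smul' c m := (smul_comm s c m)

/-- The `K`-linear dual of a left `S`-module is a left `Sᵐᵒᵖ`-module (i.e. a right
`S`-module), by precomposition. -/
def dualModuleOp [Module S M] [SMulCommClass S K M] : Module Sᵐᵒᵖ (M →ₗ[K] K) where
  smul s φ := φ ∘ₗ actMap K S M s.unop
  one_smul φ := by ext m; exact congrArg φ (one_smul S m)
  mul_smul s t φ := by ext m; exact congrArg φ (mul_smul t.unop s.unop m)
  smul_zero s := by ext m; rfl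
  smul_add s φ ψ := by ext m; rfl
  add_smul s t φ := by
    ext m
    show φ ((s.unop + t.unop) • m) = φ (s.unop • m) + φ (t.unop • m)
    rw [add_smul, map_add]
  zero_smul φ := by
    ext m
    show φ ((0 : S) • m) = 0
    rw [zero_smul, map_zero]

/-- The `K`-linear dual of a right `S`-module is a left `S`-module, by precomposition. -/
def dualModuleUnop [Module Sᵐᵒᵖ M] [SMulCommClass Sᵐᵒᵖ K M] : Module S (M →ₗ[K] K) where
  smul s φ := φ ∘ₗ actMap K Sᵐᵒᵖ M (MulOpposite.op s)
  one_smul φ := by ext m; exact congrArg φ (one_smul Sᵐᵒᵖ m)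
  mul_smul s t φ := by
    ext m
    show φ (MulOpposite.op (s * t) • m) = φ (MulOpposite.op t • MulOpposite.op s • m)
    rw [← mul_smul]
    rfl
  smul_zero s := by ext m; rfl
  smul_add s φ ψ := by ext m; rfl
  add_smul s t φ := by
    ext m
    show φ ((MulOpposite.op s + MulOpposite.op t) • m)
      = φ (MulOpposite.op s • m) + φ (MulOpposite.op t • m)
    rw [add_smul, map_add]
  zero_smul φ := by
    ext m
    show φ ((0 : Sᵐᵒᵖ) • m) = 0
    rw [zero_smul, map_zero]

end DualDefs

/-- `D R`: the `K`-linear dual of the right regular module, as a left `R`-module. -/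
def Dreg (R : Type) [Ring R] [Algebra K R] : ModuleCat.{0} R :=
  letI : Module R (R →ₗ[K] K) := dualModuleUnop K R R
  ModuleCat.of R (R →ₗ[K] K)

variable {R : Type} [Ring R] [Algebra K R]

/-- The `K`-module structure on an `R`-module, via restriction of scalars. -/
def kMod (M : ModuleCat.{0} R) : Module K M := Module.compHom M (algebraMap K R)

theorem kMod_smulCommClass (M : ModuleCat.{0} R) :
    letI := kMod K M; SMulCommClass R K M := by
  letI := kMod K M
  constructor
  intro r c m
  show r • (algebraMap K R c • m) = algebraMap K R c • (r • m)
  rw [← mul_smul, ← mul_smul, Algebra.commutes]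

theorem kMod_end_smulCommClass (M : ModuleCat.{0} R) :
    letI := kMod K M; SMulCommClass (Module.End R M) K M := by
  letI := kMod K M
  constructor
  intro f c m
  show f (algebraMap K R c • m) = algebraMap K R c • f m
  rw [map_smul]

/-- The dual `D T` of a left `R`-module `T`, as a left module over `B = End_R(T)ᵒᵖ`. -/
def DT (T : ModuleCat.{0} R) : ModuleCat.{0} ((Module.End R T)ᵐᵒᵖ) :=
  letI := kMod K T
  letI := kMod_end_smulCommClass K T
  letI : Module (Module.End R T)ᵐᵒᵖ (T →ₗ[K] K) := dualModuleOp K (Module.End R T) T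
  ModuleCat.of _ (T →ₗ[K] K)

/-- `C` is a `k`-cotilting module. -/
def IsCotilting (k : ℕ) (C : ModuleCat.{0} R) : Prop :=
  Module.Finite R C ∧ IdimLE k C ∧ ExtVanishing C C ∧
    ∃ (Y : ℕ → ModuleCat.{0} R) (f : ∀ i, Y i →ₗ[R] Y (i+1)),
      IsExactSeq (k+1) Y f ∧ Y (k+1) = Dreg K R ∧ ∀ i, i ≤ k → MemAdd C (Y i)

/-- `C` is an `I`-special `k`-cotilting module: it is `k`-cotilting, and there is a resolution
`0 → c^k → ⋯ → c^0 → D R → 0` with all `c^j ∈ add C` and `c^j ∈ add I` for `j ≤ k-1`. -/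
def IsSpecialCotilting (I : ModuleCat.{0} R) (k : ℕ) (C : ModuleCat.{0} R) : Prop :=
  IsCotilting K k C ∧
    ∃ (Y : ℕ → ModuleCat.{0} R) (f : ∀ i, Y i →ₗ[R] Y (i+1)),
      IsExactSeq (k+1) Y f ∧ Y (k+1) = Dreg K R ∧ (∀ i, i ≤ k → MemAdd C (Y i)) ∧
        (∀ i, 1 ≤ i → i ≤ k → MemAdd I (Y i))

/-- `R` is a `d`-Auslander–Gorenstein algebra: `id R ≤ d+1 ≤ domdim R`. -/
def IsAuslanderGorenstein (R : Type) [Ring R] (d : ℕ) : Prop :=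
  IdimLE (d+1) (reg R) ∧ DomdimGE R (d+1)

/-- `R` is a `d`-Auslander algebra: `gldim R ≤ d+1 ≤ domdim R`. -/
def IsAuslander (R : Type) [Ring R] (d : ℕ) : Prop :=
  GldimLE R (d+1) ∧ DomdimGE R (d+1)

end Duality

end PS
end

section
open CategoryTheory CategoryTheory.Limits Opposite

set_option linter.all false
set_option linter.unusedVariables false
set_option linter.unusedSectionVars false

namespace AbsTilt

universe v u

section basics
variable {𝒜 : Type u} [Category.{v} 𝒜] [Abelian 𝒜]

/-- Short exact sequences. -/
def SES {A B C : 𝒜} (f : A ⟶ B) (g : B ⟶ C) : Prop :=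
  Mono f ∧ Epi g ∧ ∃ w : f ≫ g = 0, (ShortComplex.mk f g w).Exact

/-- `C` is a direct sum of `A` and `B`. -/
def IsSum (A B C : 𝒜) : Prop :=
  ∃ (i₁ : A ⟶ C) (p₁ : C ⟶ A) (i₂ : B ⟶ C) (p₂ : C ⟶ B),
    i₁ ≫ p₁ = 𝟙 A ∧ i₂ ≫ p₂ = 𝟙 B ∧ i₁ ≫ p₂ = 0 ∧ i₂ ≫ p₁ = 0 ∧ p₁ ≫ i₁ + p₂ ≫ i₂ = 𝟙 C

/-- Retracts. -/
def Retr (M A : 𝒜) : Prop := ∃ (i : M ⟶ A) (p : A ⟶ M), i ≫ p = 𝟙 M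

/-- Finite powers of `X`. -/
inductive Pow (X : 𝒜) : 𝒜 → Prop
  | zero {A : 𝒜} : IsZero A → Pow X A
  | self {A : 𝒜} : (A ≅ X) → Pow X A
  | sum {A B C : 𝒜} : Pow X A → Pow X B → IsSum A B C → Pow X C

/-- The additive closure. -/
def Add (X M : 𝒜) : Prop := ∃ A, Pow X A ∧ Retr M A

/-- Left resolutions. -/
def LRes (X Z : 𝒜 → Prop) : ℕ → 𝒜 → Prop
  | 0, M => Z M
  | k+1, M => ∃ (L P : 𝒜) (i : L ⟶ P) (p : P ⟶ M), SES i p ∧ X P ∧ LRes X Z k L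

/-- Right resolutions. -/
def RRes (X Z : 𝒜 → Prop) : ℕ → 𝒜 → Prop
  | 0, M => Z M
  | k+1, M => ∃ (P L : 𝒜) (i : M ⟶ P) (p : P ⟶ L), SES i p ∧ X P ∧ RRes X Z k L

theorem SES.op {A B C : 𝒜} {f : A ⟶ B} {g : B ⟶ C} (h : SES f g) : SES g.op f.op := by
  obtain ⟨h1, h2, w, h3⟩ := h
  exact ⟨inferInstance, inferInstance, by rw [← op_comp, w, op_zero], h3.op⟩

theorem SES.unop {A B C : 𝒜ᵒᵖ} {f : A ⟶ B} {g : B ⟶ C} (h : SES f g) :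
    SES g.unop f.unop := by
  obtain ⟨h1, h2, w, h3⟩ := h
  exact ⟨inferInstance, inferInstance, by rw [← unop_comp, w, unop_zero], h3.unop⟩

theorem isSum_biprod (A B : 𝒜) : IsSum A B (A ⊞ B) :=
  ⟨biprod.inl, biprod.fst, biprod.inr, biprod.snd, by simp, by simp, by simp, by simp,
    by simp⟩

theorem IsSum.op {A B C : 𝒜} (h : IsSum A B C) : IsSum (op A) (op B) (op C) := by
  obtain ⟨i₁, p₁, i₂, p₂, h1, h2, h3, h4, h5⟩ := h
  refine ⟨p₁.op, i₁.op, p₂.op, i₂.op, ?_, ?_, ?_, ?_, ?_⟩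
  · rw [← op_comp, h1]; rfl
  · rw [← op_comp, h2]; rfl
  · rw [← op_comp, h4]; rfl
  · rw [← op_comp, h3]; rfl
  · rw [← op_comp, ← op_comp, ← op_add, h5]; rfl

theorem IsSum.unop {A B C : 𝒜ᵒᵖ} (h : IsSum A B C) :
    IsSum A.unop B.unop C.unop := by
  obtain ⟨i₁, p₁, i₂, p₂, h1, h2, h3, h4, h5⟩ := h
  refine ⟨p₁.unop, i₁.unop, p₂.unop, i₂.unop, ?_, ?_, ?_, ?_, ?_⟩
  · rw [← unop_comp, h1]; rfl
  · rw [← unop_comp, h2]; rfl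
  · rw [← unop_comp, h4]; rfl
  · rw [← unop_comp, h3]; rfl
  · rw [← unop_comp, ← unop_comp, ← unop_add, h5]; rfl

theorem Retr.op {M A : 𝒜} (h : Retr M A) : Retr (op M) (op A) := by
  obtain ⟨i, p, h⟩ := h
  exact ⟨p.op, i.op, by rw [← op_comp, h]; rfl⟩

theorem Retr.unop {M A : 𝒜ᵒᵖ} (h : Retr M A) : Retr M.unop A.unop := by
  obtain ⟨i, p, h⟩ := h
  exact ⟨p.unop, i.unop, by rw [← unop_comp, h]; rfl⟩

theorem Pow.op {X A : 𝒜} (h : Pow X A) : Pow (op X) (op A) := by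
  induction h with
  | zero h => exact .zero h.op
  | self e => exact .self e.op.symm
  | sum _ _ h h1 h2 => exact .sum h1 h2 h.op

theorem Pow.unop {X A : 𝒜ᵒᵖ} (h : Pow X A) : Pow X.unop A.unop := by
  induction h with
  | zero h => exact .zero h.unop
  | self e => exact .self e.unop.symm
  | sum _ _ h h1 h2 => exact .sum h1 h2 h.unop

theorem Add.op {X A : 𝒜} (h : Add X A) : Add (op X) (op A) := by
  obtain ⟨B, h1, h2⟩ := h
  exact ⟨_, h1.op, h2.op⟩

theorem Add.unop {X A : 𝒜ᵒᵖ} (h : Add X A) : Add X.unop A.unop := by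
  obtain ⟨B, h1, h2⟩ := h
  exact ⟨_, h1.unop, h2.unop⟩

theorem LRes.mono {X Z X' Z' : 𝒜 → Prop} (hX : ∀ A, X A → X' A) (hZ : ∀ A, Z A → Z' A) :
    ∀ (k : ℕ) (M : 𝒜), LRes X Z k M → LRes X' Z' k M
  | 0, M, h => hZ _ h
  | k+1, M, ⟨L, P, i, p, h1, h2, h3⟩ => ⟨L, P, i, p, h1, hX _ h2, LRes.mono hX hZ k L h3⟩

theorem RRes.mono {X Z X' Z' : 𝒜 → Prop} (hX : ∀ A, X A → X' A) (hZ : ∀ A, Z A → Z' A) :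
    ∀ (k : ℕ) (M : 𝒜), RRes X Z k M → RRes X' Z' k M
  | 0, M, h => hZ _ h
  | k+1, M, ⟨L, P, i, p, h1, h2, h3⟩ => ⟨L, P, i, p, h1, hX _ h2, RRes.mono hX hZ k P h3⟩

theorem LRes.op {X Z : 𝒜 → Prop} {X' Z' : 𝒜ᵒᵖ → Prop} (hX : ∀ A, X A → X' (op A))
    (hZ : ∀ A, Z A → Z' (op A)) :
    ∀ (k : ℕ) (M : 𝒜), LRes X Z k M → RRes X' Z' k (op M)
  | 0, M, h => hZ _ h
  | k+1, M, ⟨L, P, i, p, h1, h2, h3⟩ =>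
    ⟨_, _, p.op, i.op, h1.op, hX _ h2, LRes.op hX hZ k L h3⟩

theorem RRes.op {X Z : 𝒜 → Prop} {X' Z' : 𝒜ᵒᵖ → Prop} (hX : ∀ A, X A → X' (op A))
    (hZ : ∀ A, Z A → Z' (op A)) :
    ∀ (k : ℕ) (M : 𝒜), RRes X Z k M → LRes X' Z' k (op M)
  | 0, M, h => hZ _ h
  | k+1, M, ⟨P, L, i, p, h1, h2, h3⟩ =>
    ⟨_, _, p.op, i.op, h1.op, hX _ h2, RRes.op hX hZ k L h3⟩

theorem LRes.unop {X Z : 𝒜 → Prop} {X' Z' : 𝒜ᵒᵖ → Prop} (hX : ∀ A, X' A → X A.unop)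
    (hZ : ∀ A, Z' A → Z A.unop) :
    ∀ (k : ℕ) (M : 𝒜ᵒᵖ), LRes X' Z' k M → RRes X Z k M.unop
  | 0, M, h => hZ _ h
  | k+1, M, ⟨L, P, i, p, h1, h2, h3⟩ =>
    ⟨_, _, p.unop, i.unop, h1.unop, hX _ h2, LRes.unop hX hZ k L h3⟩

theorem RRes.unop {X Z : 𝒜 → Prop} {X' Z' : 𝒜ᵒᵖ → Prop} (hX : ∀ A, X' A → X A.unop)
    (hZ : ∀ A, Z' A → Z A.unop) :
    ∀ (k : ℕ) (M : 𝒜ᵒᵖ), RRes X' Z' k M → LRes X Z k M.unop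
  | 0, M, h => hZ _ h
  | k+1, M, ⟨P, L, i, p, h1, h2, h3⟩ =>
    ⟨_, _, p.unop, i.unop, h1.unop, hX _ h2, RRes.unop hX hZ k L h3⟩

/-- Kernel short exact sequence of an epimorphism. -/
theorem ses_kernel {A B : 𝒜} (p : A ⟶ B) [Epi p] : SES (kernel.ι p) p :=
  ⟨inferInstance, inferInstance, kernel.condition p,
    ShortComplex.exact_of_f_is_kernel _ (kernelIsKernel p)⟩

theorem ses_of_iso {A B Z : 𝒜} (hZ : IsZero Z) (e : A ≅ B) : SES (0 : Z ⟶ A) e.hom := by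
  refine ⟨⟨fun _ _ _ => hZ.eq_of_tgt _ _⟩, inferInstance, by simp, ?_⟩
  rw [ShortComplex.exact_iff_mono _ rfl]
  dsimp; infer_instance

theorem Retr.refl (A : 𝒜) : Retr A A := ⟨𝟙 _, 𝟙 _, by simp⟩

theorem Retr.trans {A B C : 𝒜} (h : Retr A B) (h' : Retr B C) : Retr A C := by
  obtain ⟨i, p, h⟩ := h
  obtain ⟨j, q, h'⟩ := h'
  exact ⟨i ≫ j, q ≫ p, by simp [reassoc_of% h', h]⟩

theorem Retr.of_iso {A B : 𝒜} (e : A ≅ B) : Retr A B := ⟨e.hom, e.inv, by simp⟩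

theorem Pow.add {X A : 𝒜} (h : Pow X A) : Add X A := ⟨A, h, .refl A⟩

theorem Add.self (X : 𝒜) : Add X X := (Pow.self (Iso.refl X)).add

theorem Add.retr {X A B : 𝒜} (h : Add X B) (h' : Retr A B) : Add X A := by
  obtain ⟨C, h1, h2⟩ := h
  exact ⟨C, h1, h'.trans h2⟩

theorem Add.sum {X A B C : 𝒜} (hA : Add X A) (hB : Add X B) (hC : IsSum A B C) : Add X C := by
  obtain ⟨A', hA, i, p, hip⟩ := hA
  obtain ⟨B', hB, j, q, hjq⟩ := hB
  obtain ⟨i₁, p₁, i₂, p₂, h1, h2, h3, h4, h5⟩ := hC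
  refine ⟨A' ⊞ B', .sum hA hB (isSum_biprod _ _), p₁ ≫ i ≫ biprod.inl + p₂ ≫ j ≫ biprod.inr,
    biprod.fst ≫ p ≫ i₁ + biprod.snd ≫ q ≫ i₂, ?_⟩
  simp [reassoc_of% hip, reassoc_of% hjq, h5]

theorem Add.induct {X : 𝒜} (Q : 𝒜 → Prop) (h0 : ∀ A, IsZero A → Q A) (hX : Q X)
    (hs : ∀ A B C, Q A → Q B → IsSum A B C → Q C) (hr : ∀ A B, Q B → Retr A B → Q A)
    {M : 𝒜} (h : Add X M) : Q M := by
  obtain ⟨A, hA, h⟩ := h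
  refine hr _ _ ?_ h
  clear h
  induction hA with
  | zero h => exact h0 _ h
  | self e => exact hr _ _ hX (.of_iso e)
  | sum _ _ h h1 h2 => exact hs _ _ _ h1 h2 h

theorem Add.zero (X : 𝒜) {A : 𝒜} (h : IsZero A) : Add X A := (Pow.zero h).add

theorem Add.trans {X Y M : 𝒜} (h : Add X Y) (h' : Add Y M) : Add X M :=
  Add.induct (Add X) (fun _ => Add.zero X) h (fun _ _ _ => Add.sum)
    (fun _ _ => Add.retr) h'

theorem Retr.projective {A B : 𝒜} (h : Retr A B) (hB : Projective B) : Projective A := by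
  obtain ⟨i, p, h⟩ := h
  exact ⟨fun {E X} f e he => ⟨i ≫ Projective.factorThru (p ≫ f) e, by
    rw [Category.assoc, Projective.factorThru_comp, ← Category.assoc, h, Category.id_comp]⟩⟩

theorem Retr.injective {A B : 𝒜} (h : Retr A B) (hB : Injective B) : Injective A := by
  obtain ⟨i, p, h⟩ := h
  exact ⟨fun {X Y} g f hf => ⟨Injective.factorThru (g ≫ i) f ≫ p, by
    rw [← Category.assoc, Injective.comp_factorThru, Category.assoc, h, Category.comp_id]⟩⟩

theorem IsSum.retr {A B C : 𝒜} (h : IsSum A B C) : Retr C (A ⊞ B) := by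
  obtain ⟨i₁, p₁, i₂, p₂, h1, h2, h3, h4, h5⟩ := h
  exact ⟨biprod.lift p₁ p₂, biprod.desc i₁ i₂, by simp [h5]⟩

theorem Add.projective {A B : 𝒜} (h : Add A B) (hA : Projective A) : Projective B :=
  Add.induct Projective (fun _ h => h.projective) hA
    (fun _ _ _ _ _ h => h.retr.projective inferInstance) (fun _ _ h h' => h'.projective h) h

theorem Add.injective {A B : 𝒜} (h : Add A B) (hA : Injective A) : Injective B :=
  Add.induct Injective (fun _ h => h.injective) hA
    (fun _ _ _ _ _ h => h.retr.injective inferInstance) (fun _ _ h h' => h'.injective h) h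

/-- Adding an object to the two right terms. -/
theorem ses_add {L P M : 𝒜} {i : L ⟶ P} {p : P ⟶ M} (h : SES i p) (Q : 𝒜) :
    SES (i ≫ biprod.inl : L ⟶ P ⊞ Q) (biprod.map p (𝟙 Q)) := by
  obtain ⟨h1, h2, w, h3⟩ := h
  refine ⟨inferInstance, inferInstance, by simp [reassoc_of% w], ?_⟩
  rw [ShortComplex.exact_iff_exact_up_to_refinements]
  intro A x hx
  dsimp at x hx
  have e1 : (x ≫ biprod.fst) ≫ p = 0 := by
    have := congrArg (· ≫ biprod.fst) hx
    simpa using this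
  have e2 : x ≫ biprod.snd = 0 := by
    have := congrArg (· ≫ biprod.snd) hx
    simpa using this
  obtain ⟨A', π, hπ, y, hy⟩ := h3.exact_up_to_refinements (x ≫ biprod.fst) e1
  refine ⟨A', π, hπ, y, ?_⟩
  dsimp at hy ⊢
  ext
  · simp [hy]
  · simp [e2]

/-- The kernel of a composite of epimorphisms. -/
theorem ses_comp {K T Y L P : 𝒜} {i : K ⟶ T} {p : T ⟶ Y} {j : L ⟶ P} {q : P ⟶ T}
    (h : SES i p) (h' : SES j q) :
    ∃ (W : 𝒜) (w : W ⟶ P) (a : L ⟶ W) (b : W ⟶ K), SES w (q ≫ p) ∧ SES a b := by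
  obtain ⟨h1, h2, w, h3⟩ := h
  obtain ⟨h1', h2', w', h3'⟩ := h'
  have e1 : (kernel.ι (q ≫ p) ≫ q) ≫ p = 0 := by simp
  refine ⟨kernel (q ≫ p), kernel.ι _, kernel.lift _ j (by simp [reassoc_of% w']),
    h3.lift (kernel.ι _ ≫ q) e1, ses_kernel _, ?_⟩
  have hl : h3.lift (kernel.ι (q ≫ p) ≫ q) e1 ≫ i = kernel.ι (q ≫ p) ≫ q :=
    h3.lift_f _ _
  refine ⟨mono_of_mono_fac (kernel.lift_ι _ _ _), ?_, ?_, ?_⟩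
  · rw [epi_iff_surjective_up_to_refinements]
    intro A y
    obtain ⟨A', π, hπ, x, hx⟩ := surjective_up_to_refinements_of_epi q (y ≫ i)
    refine ⟨A', π, hπ, kernel.lift _ x ?_, ?_⟩
    · rw [← reassoc_of% hx, w]; simp
    · rw [← cancel_mono i, Category.assoc, Category.assoc, hl, kernel.lift_ι_assoc]
      exact hx
  · rw [← cancel_mono i, Category.assoc, hl]
    simp [w']
  · rw [ShortComplex.exact_iff_exact_up_to_refinements]
    intro A x hx
    dsimp at x hx
    have : (x ≫ kernel.ι _) ≫ q = 0 := by
      rw [Category.assoc, ← hl, reassoc_of% hx]; simp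
    obtain ⟨A', π, hπ, y, hy⟩ := h3'.exact_up_to_refinements (x ≫ kernel.ι _) this
    refine ⟨A', π, hπ, y, ?_⟩
    dsimp at hy ⊢
    rw [← cancel_mono (kernel.ι (q ≫ p))]
    simp [hy]

/-- Pulling back along an epimorphism from a projective object. -/
theorem ses_pull {A B C L P : 𝒜} {i : A ⟶ B} {p : B ⟶ C} {j : L ⟶ P} {q : P ⟶ C}
    (h : SES i p) (h' : SES j q) (hP : Projective P) :
    ∃ (a : L ⟶ A ⊞ P) (b : A ⊞ P ⟶ B), SES a b := by
  obtain ⟨h1, h2, w, h3⟩ := h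
  obtain ⟨h1', h2', w', h3'⟩ := h'
  have hs : Projective.factorThru q p ≫ p = q := Projective.factorThru_comp q p
  generalize Projective.factorThru q p = s at hs
  have e1 : (j ≫ s) ≫ p = 0 := by rw [Category.assoc, hs, w']
  have hl : h3.lift (j ≫ s) e1 ≫ i = j ≫ s := h3.lift_f _ _
  refine ⟨biprod.lift (- h3.lift (j ≫ s) e1) j, biprod.desc i s, ?_, ?_, ?_, ?_⟩
  · exact mono_of_mono_fac (biprod.lift_snd _ _)
  · rw [epi_iff_surjective_up_to_refinements]
    intro D y
    obtain ⟨A', π, hπ, x, hx⟩ := surjective_up_to_refinements_of_epi q (y ≫ p)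
    have : (π ≫ y - x ≫ s) ≫ p = 0 := by
      rw [Preadditive.sub_comp, Category.assoc, hx, Category.assoc, hs, sub_self]
    obtain ⟨A'', π', hπ', z, hz⟩ := h3.exact_up_to_refinements _ this
    refine ⟨A'', π' ≫ π, epi_comp _ _, biprod.lift z (π' ≫ x), ?_⟩
    dsimp at hz
    simp only [biprod.lift_desc, ← hz]
    simp
  · simp [hl]
  · rw [ShortComplex.exact_iff_exact_up_to_refinements]
    intro D x hx
    dsimp at x hx
    have hx' : (x ≫ biprod.fst) ≫ i + (x ≫ biprod.snd) ≫ s = 0 := by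
      rw [← hx, ← biprod.lift_desc]
      congr 1
      ext <;> simp
    have : (x ≫ biprod.snd) ≫ q = 0 := by
      have := congrArg (· ≫ p) hx'
      simpa [w, hs] using this
    obtain ⟨A', π, hπ, y, hy⟩ := h3'.exact_up_to_refinements _ this
    refine ⟨A', π, hπ, y, ?_⟩
    dsimp at hy ⊢
    ext
    · rw [← cancel_mono i]
      simp only [Category.assoc, biprod.lift_fst, Preadditive.neg_comp, Preadditive.comp_neg, hl]
      rw [← reassoc_of% hy]
      have := congrArg (π ≫ ·) hx'
      simp only [Preadditive.comp_add, comp_zero, Category.assoc] at this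
      exact eq_neg_of_add_eq_zero_left this
    · simp [hy]

/-- `LRes` is stable under adding an object. -/
theorem LRes.add {X Z : 𝒜 → Prop} (Q : 𝒜) (hX : ∀ A, X A → X (A ⊞ Q))
    (hZ : ∀ A, Z A → Z (A ⊞ Q)) : ∀ (k : ℕ) (M : 𝒜), LRes X Z k M → LRes X Z k (M ⊞ Q)
  | 0, M, h => hZ _ h
  | k+1, M, ⟨L, P, i, p, h1, h2, h3⟩ => ⟨L, _, _, _, ses_add h1 Q, hX _ h2, h3⟩

/-- `Gen` -/
def Gen (k : ℕ) (Q M : 𝒜) : Prop := LRes (Add Q) (fun _ => True) k M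

/-- `Cogen` -/
def Cogen (k : ℕ) (Q M : 𝒜) : Prop := RRes (Add Q) (fun _ => True) k M

theorem Gen.pred {Q : 𝒜} : ∀ {k : ℕ} {M : 𝒜}, Gen (k+1) Q M → Gen k Q M
  | 0, _, _ => trivial
  | _+1, _, ⟨L, P, i, p, h1, h2, h3⟩ => ⟨L, P, i, p, h1, h2, Gen.pred h3⟩

theorem Gen.addObj {Q P M : 𝒜} (hP : Add Q P) {k : ℕ} (h : Gen k Q M) : Gen k Q (M ⊞ P) :=
  LRes.add P (fun _ h => h.sum hP (isSum_biprod _ _)) (fun _ _ => trivial) k M h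

theorem Gen.ext_quot {Q : 𝒜} (hQ : Projective Q) (k : ℕ) :
    (∀ {A B C : 𝒜} {i : A ⟶ B} {p : B ⟶ C}, SES i p → Gen k Q A → Gen k Q C → Gen k Q B) ∧
    (∀ {A B C : 𝒜} {i : A ⟶ B} {p : B ⟶ C}, SES i p → Gen k Q A → Gen (k+1) Q B →
      Gen (k+1) Q C) := by
  have key : ∀ k, (∀ {A B C : 𝒜} {i : A ⟶ B} {p : B ⟶ C}, SES i p → Gen k Q A → Gen k Q C →
      Gen k Q B) → (∀ {A B C : 𝒜} {i : A ⟶ B} {p : B ⟶ C}, SES i p → Gen k Q A →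
      Gen (k+1) Q B → Gen (k+1) Q C) := by
    rintro k hk A B C i p h hA ⟨L, P, j, q, h1, h2, h3⟩
    obtain ⟨W, w, a, b, e1, e2⟩ := ses_comp h h1
    exact ⟨W, P, w, _, e1, h2, hk e2 h3 hA⟩
  suffices h : ∀ {A B C : 𝒜} {i : A ⟶ B} {p : B ⟶ C}, SES i p → Gen k Q A → Gen k Q C →
      Gen k Q B from ⟨h, key k h⟩
  induction k with
  | zero => intros; trivial
  | succ k ih =>
    rintro A B C i p h hA ⟨L, P, j, q, h1, h2, h3⟩
    obtain ⟨a, b, e⟩ := ses_pull h h1 (h2.projective hQ)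
    exact key k ih e h3 (hA.addObj h2)

theorem Gen.of_iso {Q A B : 𝒜} (e : A ≅ B) : ∀ {k : ℕ}, Gen k Q A → Gen k Q B
  | 0, _ => trivial
  | k+1, ⟨L, P, i, p, ⟨h1, h1', w, h1''⟩, h2, h3⟩ =>
    ⟨L, P, i, p ≫ e.hom, ⟨h1, inferInstance, by simp [reassoc_of% w], by
      refine ShortComplex.exact_of_iso ?_ h1''
      exact ShortComplex.isoMk (Iso.refl _) (Iso.refl _) e (by simp) (by simp)⟩, h2, h3⟩

theorem Gen.zero {Q A : 𝒜} (hA : IsZero A) : ∀ {k : ℕ}, Gen k Q A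
  | 0 => trivial
  | _+1 => ⟨A, A, 0, 𝟙 _, ses_of_iso hA (Iso.refl A), Add.zero _ hA, Gen.zero hA⟩

theorem IsSum.ses {A B C : 𝒜} (h : IsSum A B C) : ∃ (i : A ⟶ C) (p : C ⟶ B), SES i p := by
  obtain ⟨i₁, p₁, i₂, p₂, h1, h2, h3, h4, h5⟩ := h
  have m : Mono i₁ := mono_of_mono_fac h1
  have e : Epi p₂ := epi_of_epi_fac h2
  refine ⟨i₁, p₂, m, e, h3, ?_⟩
  rw [ShortComplex.exact_iff_exact_up_to_refinements]
  intro D x hx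
  dsimp at x hx
  refine ⟨D, 𝟙 _, inferInstance, x ≫ p₁, ?_⟩
  dsimp
  have := congrArg (x ≫ ·) h5
  simp only [Preadditive.comp_add, reassoc_of% hx, zero_comp, add_zero, Category.comp_id] at this
  simp [this]

theorem Gen.pow {Q T A : 𝒜} (hQ : Projective Q) {k : ℕ} (hT : Gen k Q T) (h : Pow T A) :
    Gen k Q A := by
  induction h with
  | zero h => exact .zero h
  | self e => exact .of_iso e.symm hT
  | sum _ _ h h1 h2 =>
    obtain ⟨i, p, h⟩ := h.ses
    exact (Gen.ext_quot hQ k).1 h h1 h2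

theorem Gen.lres {Q T : 𝒜} (hQ : Projective Q) : ∀ {k : ℕ} {M : 𝒜}, Gen k Q T →
    LRes (Pow T) (fun _ => True) k M → Gen k Q M
  | 0, _, _, _ => trivial
  | k+1, _, hT, ⟨_, _, _, _, h1, h2, h3⟩ =>
    (Gen.ext_quot hQ k).2 h1 (Gen.lres hQ hT.pred h3) (Gen.pow hQ hT h2)

end basics

end AbsTilt
end

section
open CategoryTheory CategoryTheory.Limits Opposite

set_option linter.all false
set_option linter.unusedVariables false
set_option linter.unusedSectionVars false

namespace AbsTilt

universe v u

/-- The self-dual list of facts about finitely generated modules over a finite-dimensional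
algebra used in the argument; `EV n X Y` stands for `Ext^(n+1)(X, Y) = 0`. -/
structure Setup (𝒜 : Type u) [Category.{v} 𝒜] [Abelian 𝒜] where
  fin : 𝒜 → Prop
  EV : ℕ → 𝒜 → 𝒜 → Prop
  G : 𝒜
  J : 𝒜
  fin_mono : ∀ {A B : 𝒜} (f : A ⟶ B), Mono f → fin B → fin A
  fin_epi : ∀ {A B : 𝒜} (f : A ⟶ B), Epi f → fin A → fin B
  fin_sum : ∀ {A B : 𝒜}, fin A → fin B → fin (A ⊞ B)
  fin_G : fin G
  fin_J : fin J
  proj_G : Projective G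
  inj_J : Injective J
  gen_G : ∀ {X : 𝒜}, fin X → ∃ (A : 𝒜) (f : A ⟶ X), Add G A ∧ Epi f
  cogen_J : ∀ {X : 𝒜}, fin X → ∃ (A : 𝒜) (f : X ⟶ A), Add J A ∧ Mono f
  approx : ∀ {T X : 𝒜}, fin T → fin X → ∃ (A : 𝒜) (f : A ⟶ X), Pow T A ∧
    ∀ g : T ⟶ X, ∃ h : T ⟶ A, h ≫ f = g
  coapprox : ∀ {T X : 𝒜}, fin T → fin X → ∃ (A : 𝒜) (f : X ⟶ A), Pow T A ∧
    ∀ g : X ⟶ T, ∃ h : A ⟶ T, f ≫ h = g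
  ev_proj : ∀ {P Y : 𝒜} {n : ℕ}, Projective P → EV n P Y
  ev_inj : ∀ {P Y : 𝒜} {n : ℕ}, Injective P → EV n Y P
  cov2 : ∀ {A B C W : 𝒜} {i : A ⟶ B} {p : B ⟶ C} {n : ℕ}, SES i p →
    EV n W A → EV n W C → EV n W B
  cov3 : ∀ {A B C W : 𝒜} {i : A ⟶ B} {p : B ⟶ C} {n : ℕ}, SES i p →
    EV n W B → EV (n+1) W A → EV n W C
  cov1 : ∀ {A B C W : 𝒜} {i : A ⟶ B} {p : B ⟶ C} {n : ℕ}, SES i p →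
    EV n W C → EV (n+1) W B → EV (n+1) W A
  con2 : ∀ {A B C W : 𝒜} {i : A ⟶ B} {p : B ⟶ C} {n : ℕ}, SES i p →
    EV n C W → EV n A W → EV n B W
  con1 : ∀ {A B C W : 𝒜} {i : A ⟶ B} {p : B ⟶ C} {n : ℕ}, SES i p →
    EV n B W → EV (n+1) C W → EV n A W
  con3 : ∀ {A B C W : 𝒜} {i : A ⟶ B} {p : B ⟶ C} {n : ℕ}, SES i p →
    EV n A W → EV (n+1) B W → EV (n+1) C W
  cov0 : ∀ {A B C W : 𝒜} {i : A ⟶ B} {p : B ⟶ C}, SES i p →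
    EV 0 W B → (∀ f : W ⟶ C, ∃ g : W ⟶ B, g ≫ p = f) → EV 0 W A
  con0 : ∀ {A B C W : 𝒜} {i : A ⟶ B} {p : B ⟶ C}, SES i p →
    EV 0 B W → (∀ f : A ⟶ W, ∃ g : B ⟶ W, i ≫ g = f) → EV 0 C W
  covh : ∀ {A B C W : 𝒜} {i : A ⟶ B} {p : B ⟶ C}, SES i p →
    EV 0 W A → ∀ f : W ⟶ C, ∃ g : W ⟶ B, g ≫ p = f
  conh : ∀ {A B C W : 𝒜} {i : A ⟶ B} {p : B ⟶ C}, SES i p →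
    EV 0 C W → ∀ f : A ⟶ W, ∃ g : B ⟶ W, i ≫ g = f
  ev_retr_left : ∀ {A B W : 𝒜} {n : ℕ}, Retr A B → EV n B W → EV n A W
  ev_retr_right : ∀ {A B W : 𝒜} {n : ℕ}, Retr A B → EV n W B → EV n W A

namespace Setup

variable {𝒜 : Type u} [Category.{v} 𝒜] [Abelian 𝒜] (S : Setup 𝒜)

theorem fin_retr {A B : 𝒜} (h : Retr A B) (hB : S.fin B) : S.fin A := by
  obtain ⟨i, p, h⟩ := h
  exact S.fin_mono i (mono_of_mono_fac h) hB

/-- The opposite setup. -/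
def opp : Setup 𝒜ᵒᵖ where
  fin X := S.fin X.unop
  EV n X Y := S.EV n Y.unop X.unop
  G := op S.J
  J := op S.G
  fin_mono f hf h := S.fin_epi f.unop inferInstance h
  fin_epi f hf h := S.fin_mono f.unop inferInstance h
  fin_sum {A B} hA hB := by
    have h := (isSum_biprod A B).unop
    exact S.fin_retr h.retr (S.fin_sum hA hB)
  fin_G := S.fin_J
  fin_J := S.fin_G
  proj_G := by have := S.inj_J; infer_instance
  inj_J := by have := S.proj_G; infer_instance
  gen_G {X} h := by
    obtain ⟨A, f, h1, h2⟩ := S.cogen_J h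
    exact ⟨op A, f.op, h1.op, inferInstance⟩
  cogen_J {X} h := by
    obtain ⟨A, f, h1, h2⟩ := S.gen_G h
    exact ⟨op A, f.op, h1.op, inferInstance⟩
  approx {T X} hT hX := by
    obtain ⟨A, f, h1, h2⟩ := S.coapprox hT hX
    refine ⟨op A, f.op, h1.op, fun g => ?_⟩
    obtain ⟨h, hh⟩ := h2 g.unop
    exact ⟨h.op, by rw [← op_comp, hh]; rfl⟩
  coapprox {T X} hT hX := by
    obtain ⟨A, f, h1, h2⟩ := S.approx hT hX
    refine ⟨op A, f.op, h1.op, fun g => ?_⟩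
    obtain ⟨h, hh⟩ := h2 g.unop
    exact ⟨h.op, by rw [← op_comp, hh]; rfl⟩
  ev_proj h := S.ev_inj inferInstance
  ev_inj h := S.ev_proj inferInstance
  cov2 h h1 h2 := S.con2 h.unop h1 h2
  cov3 h h1 h2 := S.con1 h.unop h1 h2
  cov1 h h1 h2 := S.con3 h.unop h1 h2
  con2 h h1 h2 := S.cov2 h.unop h1 h2
  con1 h h1 h2 := S.cov3 h.unop h1 h2
  con3 h h1 h2 := S.cov1 h.unop h1 h2
  cov0 h h1 h2 := S.con0 h.unop h1 (fun f => by
    obtain ⟨g, hg⟩ := h2 f.op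
    exact ⟨g.unop, congrArg Quiver.Hom.unop hg⟩)
  con0 h h1 h2 := S.cov0 h.unop h1 (fun f => by
    obtain ⟨g, hg⟩ := h2 f.op
    exact ⟨g.unop, congrArg Quiver.Hom.unop hg⟩)
  covh h h1 f := by
    obtain ⟨g, hg⟩ := S.conh h.unop h1 f.unop
    exact ⟨g.op, congrArg Quiver.Hom.op hg⟩
  conh h h1 f := by
    obtain ⟨g, hg⟩ := S.covh h.unop h1 f.unop
    exact ⟨g.op, congrArg Quiver.Hom.op hg⟩
  ev_retr_left h h1 := S.ev_retr_right h.unop h1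
  ev_retr_right h h1 := S.ev_retr_left h.unop h1

/-- Projective dimension. -/
def Pd (k : ℕ) (M : 𝒜) : Prop := LRes Projective Projective k M

/-- Tilting objects. -/
def Tilt (k : ℕ) (T : 𝒜) : Prop :=
  S.fin T ∧ Pd k T ∧ (∀ n, S.EV n T T) ∧ RRes (Add T) (Add T) k S.G

theorem fin_add {T A : 𝒜} (hT : S.fin T) (h : Add T A) : S.fin A :=
  Add.induct S.fin (fun A hA => S.fin_mono (0 : A ⟶ T) ⟨fun _ _ _ => hA.eq_of_tgt _ _⟩ hT) hT
    (fun _ _ _ h1 h2 h3 => S.fin_retr h3.retr (S.fin_sum h1 h2))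
    (fun _ _ h1 h2 => S.fin_retr h2 h1) h

theorem ev_add_left {T A W : 𝒜} {n : ℕ} (h : S.EV n T W) (hA : Add T A) : S.EV n A W :=
  Add.induct (fun A => S.EV n A W) (fun A hA => S.ev_proj hA.projective) h
    (fun _ _ _ h1 h2 h3 => by
      obtain ⟨i, p, h⟩ := h3.ses
      exact S.con2 h h2 h1) (fun _ _ h1 h2 => S.ev_retr_left h2 h1) hA

theorem ev_add_right {T A W : 𝒜} {n : ℕ} (h : S.EV n W T) (hA : Add T A) : S.EV n W A :=
  Add.induct (fun A => S.EV n W A) (fun A hA => S.ev_inj hA.injective) h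
    (fun _ _ _ h1 h2 h3 => by
      obtain ⟨i, p, h⟩ := h3.ses
      exact S.cov2 h h1 h2) (fun _ _ h1 h2 => S.ev_retr_right h2 h1) hA

theorem ev_of_pd (W : 𝒜) : ∀ {k : ℕ} {M : 𝒜}, Pd k M → ∀ n, k ≤ n → S.EV n M W
  | 0, _, h, _, _ => S.ev_proj h
  | k+1, _, ⟨_, _, _, _, h1, h2, h3⟩, n, hn => by
    obtain ⟨n, rfl⟩ : ∃ m, n = m + 1 := ⟨n - 1, by omega⟩
    exact S.con3 h1 (ev_of_pd W h3 n (by omega)) (S.ev_proj h2)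

theorem ev_shift {X : 𝒜 → Prop} {W : 𝒜} (hX : ∀ P, X P → ∀ n, S.EV n W P) :
    ∀ {k : ℕ} {M : 𝒜} (m : ℕ), (∀ Y n, k + m ≤ n → S.EV n W Y) →
      LRes X (fun _ => True) k M → ∀ n, m ≤ n → S.EV n W M
  | 0, M, m, h, _, n, hn => h M n (by omega)
  | k+1, M, m, h, ⟨L, P, i, p, h1, h2, h3⟩, n, hn =>
    S.cov3 h1 (hX _ h2 n) (ev_shift hX (m+1) (fun Y n hn => h Y n (by omega)) h3 (n+1) (by omega))

theorem ev_shift' {X : 𝒜 → Prop} {W M : 𝒜} {k : ℕ} (hX : ∀ P, X P → ∀ n, S.EV n W P)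
    (hW : Pd k W) (hM : LRes X (fun _ => True) k M) (n : ℕ) : S.EV n W M :=
  S.ev_shift hX 0 (fun Y n hn => S.ev_of_pd Y hW n (by omega)) hM n (by omega)

/-- Objects of `Gen k Q` of projective dimension at most `k` are mutually orthogonal. -/
theorem ev_gen {Q X Y : 𝒜} (hQ : Injective Q) {k : ℕ} (hX : Pd k X) (hY : Gen k Q Y) (n : ℕ) :
    S.EV n X Y :=
  S.ev_shift' (fun P hP n => S.ev_inj (hP.injective hQ)) hX hY n

theorem ev_rres {T Y : 𝒜} (hY : ∀ n, S.EV n T Y) : ∀ {k : ℕ} {M : 𝒜},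
    RRes (Add T) (Add T) k M → ∀ n, S.EV n M Y
  | 0, _, h, n => S.ev_add_left (hY n) h
  | k+1, _, ⟨_, _, _, _, h1, h2, h3⟩, n =>
    S.con1 h1 (S.ev_add_left (hY n) h2) (ev_rres hY h3 (n+1))

theorem lift_add {T A B Y : 𝒜} (f : B ⟶ Y) (h : ∀ g : T ⟶ Y, ∃ h : T ⟶ B, h ≫ f = g)
    (hA : Add T A) : ∀ g : A ⟶ Y, ∃ h : A ⟶ B, h ≫ f = g := by
  refine Add.induct (fun A => ∀ g : A ⟶ Y, ∃ h : A ⟶ B, h ≫ f = g) ?_ h ?_ ?_ hA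
  · intro A hA g
    exact ⟨0, hA.eq_of_src _ _⟩
  · rintro A B C hA hB ⟨i₁, p₁, i₂, p₂, h1, h2, h3, h4, h5⟩ g
    obtain ⟨a, ha⟩ := hA (i₁ ≫ g)
    obtain ⟨b, hb⟩ := hB (i₂ ≫ g)
    refine ⟨p₁ ≫ a + p₂ ≫ b, ?_⟩
    rw [Preadditive.add_comp, Category.assoc, Category.assoc, ha, hb, ← Category.assoc,
      ← Category.assoc, ← Preadditive.add_comp, h5, Category.id_comp]
  · rintro A B hB ⟨i, p, hip⟩ g
    obtain ⟨a, ha⟩ := hB (p ≫ g)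
    exact ⟨i ≫ a, by rw [Category.assoc, ha, ← Category.assoc, hip, Category.id_comp]⟩

theorem exists_res {k : ℕ} {T Y : 𝒜} (hT : S.Tilt k T) (hf : S.fin Y) (hY : ∀ n, S.EV n T Y) :
    ∃ (K T₀ : 𝒜) (i : K ⟶ T₀) (p : T₀ ⟶ Y), SES i p ∧ Pow T T₀ ∧ S.fin K ∧
      ∀ n, S.EV n T K := by
  obtain ⟨hTf, hpd, hTT, hr⟩ := hT
  obtain ⟨T₀, p, hT₀, hp⟩ := S.approx hTf hf
  have hpT := fun A (hA : Add T A) => lift_add p hp hA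
  have hpG : ∀ g : S.G ⟶ Y, ∃ h : S.G ⟶ T₀, h ≫ p = g := by
    intro g
    cases k with
    | zero => exact hpT _ hr g
    | succ k =>
      obtain ⟨t, L, i, q, h1, h2, h3⟩ := hr
      obtain ⟨g', hg'⟩ := S.conh h1 (S.ev_rres hY h3 0) g
      obtain ⟨h, hh⟩ := hpT _ h2 g'
      exact ⟨i ≫ h, by rw [Category.assoc, hh, hg']⟩
  obtain ⟨A, f, hA, hfe⟩ := S.gen_G hf
  obtain ⟨h, hh⟩ := lift_add p hpG hA f
  have hpe : Epi p := epi_of_epi_fac hh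
  have hses := ses_kernel p
  have hT₀f := S.fin_add hTf hT₀.add
  refine ⟨_, T₀, _, p, hses, hT₀, S.fin_mono _ hses.1 hT₀f, ?_⟩
  intro n
  cases n with
  | zero => exact S.cov0 hses (S.ev_add_right (hTT 0) hT₀.add) hp
  | succ n => exact S.cov1 hses (hY n) (S.ev_add_right (hTT _) hT₀.add)

theorem exists_lres {k : ℕ} {T : 𝒜} (hT : S.Tilt k T) : ∀ (m : ℕ) {Y : 𝒜} (hf : S.fin Y)
    (hY : ∀ n, S.EV n T Y), LRes (Pow T) (fun _ => True) m Y
  | 0, _, _, _ => trivial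
  | m+1, _, hf, hY => by
    obtain ⟨K, T₀, i, p, h1, h2, h3, h4⟩ := S.exists_res hT hf hY
    exact ⟨K, T₀, i, p, h1, h2, exists_lres hT m h3 h4⟩

theorem add_of_orth {k : ℕ} {T X : 𝒜} (hT : S.Tilt k T) (hf : S.fin X) (hX : Pd k X)
    (h1 : ∀ n, S.EV n T X) (h2 : ∀ n, S.EV n X T) : Add T X := by
  obtain ⟨K, T₀, i, p, h3, h4, h5, h6⟩ := S.exists_res hT hf h1
  have h7 := S.ev_shift' (W := X) (X := Pow T) (fun P hP n => S.ev_add_right (h2 n) hP.add) hX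
    (S.exists_lres hT k h5 h6) 0
  obtain ⟨s, hs⟩ := S.covh h3 h7 (𝟙 X)
  exact ⟨T₀, h4, s, p, hs⟩

/-- A tilting object in `Gen k Q` forces the injective cogenerator into `Gen k Q`. -/
theorem gen_J {k : ℕ} {T Q : 𝒜} (hQ : Projective Q) (hT : S.Tilt k T) (hg : Gen k Q T) :
    Gen k Q S.J :=
  Gen.lres hQ hg (S.exists_lres hT k S.fin_J (fun _ => S.ev_inj S.inj_J))

theorem exists_coker {Q : 𝒜} (hQf : S.fin Q) (hQ : Projective Q) {Z : 𝒜 → Prop} :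
    ∀ {k j : ℕ} {M : 𝒜}, RRes (Add Q) Z k M → Pd j M → Gen j Q M → S.fin M →
    ∃ N, Z N ∧ S.fin N ∧ Pd (j+k) N ∧ Gen (j+k) Q N ∧ RRes (Add Q) (Add N) k M
  | 0, j, M, h, h1, h2, h3 => ⟨M, h, h3, h1, h2, .self M⟩
  | k+1, j, M, ⟨P, L, i, p, e1, e2, e3⟩, h1, h2, h3 => by
    obtain ⟨N, f1, f2, f3, f4, f5⟩ := exists_coker hQf hQ (j := j+1) e3
      ⟨M, P, i, p, e1, e2.projective hQ, h1⟩ ⟨M, P, i, p, e1, e2, h2⟩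
      (S.fin_epi p e1.2.1 (S.fin_add hQf e2))
    refine ⟨N, f1, f2, ?_, ?_, P, L, i, p, e1, e2, f5⟩
    · rwa [show j + (k+1) = j + 1 + k by omega]
    · rwa [show j + (k+1) = j + 1 + k by omega]

/-- Construction of the special tilting object. -/
theorem exists_special {k : ℕ} {Q : 𝒜} (hQf : S.fin Q) (hQp : Projective Q)
    (hQi : Injective Q) {Z : 𝒜 → Prop}
    (h : RRes (Add Q) Z k S.G) :
    ∃ N, Z N ∧ S.Tilt k (N ⊞ Q) ∧ Gen k Q (N ⊞ Q) ∧ RRes (Add Q) (Add (N ⊞ Q)) k S.G := by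
  obtain ⟨N, h1, h2, h3, h4, h5⟩ := S.exists_coker hQf hQp h (j := 0) S.proj_G trivial S.fin_G
  rw [Nat.zero_add] at h3 h4
  have hN : Add (N ⊞ Q) N := (Add.self _).retr ⟨biprod.inl, biprod.fst, by simp⟩
  have hQ : Add (N ⊞ Q) Q := (Add.self _).retr ⟨biprod.inr, biprod.snd, by simp⟩
  have hg : Gen k Q (N ⊞ Q) := h4.addObj (.self Q)
  have hpd : Pd k (N ⊞ Q) := LRes.add (X := Projective) (Z := Projective) Q (fun _ _ => inferInstance) (fun _ _ => inferInstance) k N h3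
  refine ⟨N, h1, ⟨S.fin_sum h2 hQf, hpd, fun n => S.ev_gen hQi hpd hg n, ?_⟩, hg, ?_⟩
  · exact RRes.mono (fun A hA => hQ.trans hA) (fun A hA => hN.trans hA) k _ h5
  · exact RRes.mono (fun A hA => hA) (fun A hA => hN.trans hA) k _ h5

theorem mono_add {T A : 𝒜} {k : ℕ} (hr : RRes (Add T) (Add T) k S.G) (hA : Add S.G A) :
    ∃ (t : 𝒜) (i : A ⟶ t), Mono i ∧ Add T t := by
  refine Add.induct (fun A => ∃ (t : 𝒜) (i : A ⟶ t), Mono i ∧ Add T t) ?_ ?_ ?_ ?_ hA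
  · intro A hA
    exact ⟨A, 𝟙 A, inferInstance, Add.zero _ hA⟩
  · cases k with
    | zero => exact ⟨_, 𝟙 _, inferInstance, hr⟩
    | succ k =>
      obtain ⟨t, L, i, q, h1, h2, h3⟩ := hr
      exact ⟨t, i, h1.1, h2⟩
  · rintro A B C ⟨t, i, hi, ht⟩ ⟨t', i', hi', ht'⟩ hs
    obtain ⟨j, p, hj⟩ := hs.retr
    have : Mono j := mono_of_mono_fac hj
    exact ⟨t ⊞ t', j ≫ biprod.map i i', mono_comp _ _, ht.sum ht' (isSum_biprod _ _)⟩
  · rintro A B ⟨t, i, hi, ht⟩ ⟨j, p, hj⟩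
    have : Mono j := mono_of_mono_fac hj
    exact ⟨t, j ≫ i, mono_comp _ _, ht⟩

theorem add_of_injective {k : ℕ} {Q T : 𝒜} (hQf : S.fin Q) (hQp : Projective Q)
    (hQi : Injective Q) (hT : S.Tilt k T) : Add T Q := by
  obtain ⟨-, -, -, hr⟩ := hT
  obtain ⟨A, f, hA, hf⟩ := S.gen_G hQf
  have hQ : Add S.G Q := hA.retr ⟨Projective.factorThru (𝟙 Q) f, f,
    Projective.factorThru_comp _ _⟩
  obtain ⟨t, i, hi, ht⟩ := S.mono_add hr hQ
  exact ht.retr ⟨i, Injective.factorThru (𝟙 Q) i, Injective.comp_factorThru _ _⟩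

theorem unique {k : ℕ} {Q T T' : 𝒜} (hQf : S.fin Q) (hQp : Projective Q) (hQi : Injective Q)
    (hT : S.Tilt k T) (hTg : Gen k Q T) (hT' : S.Tilt k T')
    (h : RRes (Add Q) (Add T') k S.G) : Add T T' ∧ Add T' T := by
  obtain ⟨N, h1, h2, h3, -⟩ := S.exists_special hQf hQp hQi h
  have hQ : Add T' Q := S.add_of_injective hQf hQp hQi hT'
  have a1 : Add T' (N ⊞ Q) := h1.sum hQ (isSum_biprod _ _)
  have a2 : Add (N ⊞ Q) T' := S.add_of_orth h2 hT'.1 hT'.2.1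
    (fun n => S.ev_add_left (hT'.2.2.1 n) a1) (fun n => S.ev_add_right (hT'.2.2.1 n) a1)
  have a3 : Add T (N ⊞ Q) := S.add_of_orth hT h2.1 h2.2.1
    (fun n => S.ev_gen hQi hT.2.1 h3 n) (fun n => S.ev_gen hQi h2.2.1 hTg n)
  have a4 : Add (N ⊞ Q) T := S.add_of_orth h2 hT.1 hT.2.1
    (fun n => S.ev_gen hQi h2.2.1 hTg n) (fun n => S.ev_gen hQi hT.2.1 h3 n)
  exact ⟨a3.trans a2, a1.trans a4⟩

/-- Cotilting objects. -/
def Cotilt (k : ℕ) (T : 𝒜) : Prop :=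
  S.fin T ∧ RRes Injective Injective k T ∧ (∀ n, S.EV n T T) ∧ LRes (Add T) (Add T) k S.J

theorem tilt_opp_iff {k : ℕ} {T : 𝒜} : S.opp.Tilt k (op T) ↔ S.Cotilt k T := by
  have e1 : ∀ A : 𝒜ᵒᵖ, Projective A → Injective A.unop := fun A h => inferInstance
  have e2 : ∀ A : 𝒜, Injective A → Projective (op A) := fun A h => inferInstance
  have e3 : ∀ A : 𝒜ᵒᵖ, Add (op T) A → Add T A.unop := fun A h => h.unop
  have e4 : ∀ A : 𝒜, Add T A → Add (op T) (op A) := fun A h => h.op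
  have a1 : Pd k (op T) ↔ RRes Injective Injective k T :=
    ⟨fun h => LRes.unop e1 e1 k (op T) h, fun h => RRes.op e2 e2 k T h⟩
  have a2 : RRes (Add (op T)) (Add (op T)) k (op S.J) ↔ LRes (Add T) (Add T) k S.J :=
    ⟨fun h => RRes.unop e3 e3 k (op S.J) h, fun h => LRes.op e4 e4 k S.J h⟩
  exact and_congr Iff.rfl (and_congr a1 (and_congr Iff.rfl a2))

theorem gen_op_iff {k : ℕ} {Q T : 𝒜} : Gen k (op Q) (op T) ↔ Cogen k Q T := by
  have e3 : ∀ A : 𝒜ᵒᵖ, Add (op Q) A → Add Q A.unop := fun A h => h.unop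
  have e4 : ∀ A : 𝒜, Add Q A → Add (op Q) (op A) := fun A h => h.op
  exact ⟨fun h => LRes.unop e3 (fun A h => h) k (op T) h, fun h => RRes.op e4 (fun A h => h) k T h⟩

theorem cogen_of_cotilt {k : ℕ} {C Q : 𝒜} (hQi : Injective Q) (hC : S.Cotilt k C)
    (hg : Cogen k Q C) : Cogen k Q S.G :=
  gen_op_iff.1 (S.opp.gen_J (T := op C) (Q := op Q) inferInstance (S.tilt_opp_iff.2 hC)
    (gen_op_iff.2 hg))

theorem cotilt_of_gen {k : ℕ} {Q : 𝒜} (hQf : S.fin Q) (hQp : Projective Q) (hQi : Injective Q)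
    (h : Gen k Q S.J) : ∃ C, S.Cotilt k C ∧ Cogen k Q C := by
  obtain ⟨N, -, h1, h2, -⟩ := S.opp.exists_special (k := k) (Q := op Q) hQf inferInstance
    inferInstance (Z := fun _ => True) (LRes.op (fun A h => h.op) (fun _ h => h) k _ h)
  generalize (N ⊞ op Q) = C at h1 h2
  exact ⟨C.unop, S.tilt_opp_iff.1 h1, gen_op_iff.1 h2⟩

theorem tilt_iff {k : ℕ} {Q : 𝒜} (hQf : S.fin Q) (hQp : Projective Q) (hQi : Injective Q) :
    (∃ T, Gen k Q T ∧ S.Tilt k T) ↔ Cogen k Q S.G := by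
  constructor
  · rintro ⟨T, h1, h2⟩
    obtain ⟨C, h3, h4⟩ := S.cotilt_of_gen hQf hQp hQi (S.gen_J hQp h2 h1)
    exact S.cogen_of_cotilt hQi h3 h4
  · intro h
    obtain ⟨N, -, h1, h2, -⟩ := S.exists_special hQf hQp hQi h
    exact ⟨_, h2, h1⟩

theorem cotilt_iff {k : ℕ} {Q : 𝒜} (hQf : S.fin Q) (hQp : Projective Q) (hQi : Injective Q) :
    (∃ C, Cogen k Q C ∧ S.Cotilt k C) ↔ Cogen k Q S.G := by
  constructor
  · rintro ⟨C, h1, h2⟩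
    exact S.cogen_of_cotilt hQi h2 h1
  · intro h
    obtain ⟨T, h1, h2⟩ := (S.tilt_iff hQf hQp hQi).2 h
    obtain ⟨C, h3, h4⟩ := S.cotilt_of_gen hQf hQp hQi (S.gen_J hQp h2 h1)
    exact ⟨C, h4, h3⟩

theorem unique' {k : ℕ} {Q C C' : 𝒜} (hQf : S.fin Q) (hQp : Projective Q) (hQi : Injective Q)
    (hC : S.Cotilt k C) (hg : Cogen k Q C) (hC' : S.Cotilt k C')
    (h : LRes (Add Q) (Add C') k S.J) : Add C C' ∧ Add C' C := by
  have := S.opp.unique (Q := op Q) (T := op C) (T' := op C') hQf inferInstance inferInstance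
    (S.tilt_opp_iff.2 hC) (gen_op_iff.2 hg) (S.tilt_opp_iff.2 hC')
    (LRes.op (fun A h => h.op) (fun _ h => h.op) k _ h)
  exact ⟨this.1.unop, this.2.unop⟩

end Setup

end AbsTilt
end

section
open CategoryTheory CategoryTheory.Limits Opposite

set_option linter.all false

namespace AbsTilt

universe w v u

section extlem
variable {𝒜 : Type u} [Category.{v} 𝒜] [Abelian 𝒜] [HasExt.{w} 𝒜]

theorem SES.shortExact {A B C : 𝒜} {i : A ⟶ B} {p : B ⟶ C} (h : SES i p) :
    ∃ w : i ≫ p = 0, (ShortComplex.mk i p w).ShortExact := by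
  obtain ⟨h1, h2, w, h3⟩ := h
  exact ⟨w, ⟨h3⟩⟩

/-- Vanishing of the `(n+1)`-st Ext group. -/
def EVx (n : ℕ) (X Y : 𝒜) : Prop := Subsingleton (Abelian.Ext.{w} X Y (n+1))

open Abelian

theorem evx_iff {n : ℕ} {X Y : 𝒜} : EVx.{w} n X Y ↔ ∀ x : Ext.{w} X Y (n+1), x = 0 :=
  subsingleton_iff_forall_eq 0

variable {A B C W : 𝒜} {i : A ⟶ B} {p : B ⟶ C} {n : ℕ}

theorem EVx.cov2 (h : SES i p) (h1 : EVx.{w} n W A) (h2 : EVx.{w} n W C) : EVx.{w} n W B := by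
  obtain ⟨w, hS⟩ := h.shortExact
  rw [evx_iff] at *
  intro x
  obtain ⟨y, hy⟩ := Ext.covariant_sequence_exact₂ W hS x (h2 _)
  rw [← hy, h1 y, Ext.zero_comp]

theorem EVx.cov3 (h : SES i p) (h1 : EVx.{w} n W B) (h2 : EVx.{w} (n+1) W A) : EVx.{w} n W C := by
  obtain ⟨w, hS⟩ := h.shortExact
  rw [evx_iff] at *
  intro x
  obtain ⟨y, hy⟩ := Ext.covariant_sequence_exact₃ W hS x rfl (h2 _)
  rw [← hy, h1 y, Ext.zero_comp]

theorem EVx.cov1 (h : SES i p) (h1 : EVx.{w} n W C) (h2 : EVx.{w} (n+1) W B) :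
    EVx.{w} (n+1) W A := by
  obtain ⟨w, hS⟩ := h.shortExact
  rw [evx_iff] at *
  intro x
  obtain ⟨y, hy⟩ := Ext.covariant_sequence_exact₁ W hS x (h2 _) rfl
  rw [← hy, h1 y, Ext.zero_comp]

theorem EVx.con2 (h : SES i p) (h1 : EVx.{w} n C W) (h2 : EVx.{w} n A W) : EVx.{w} n B W := by
  obtain ⟨w, hS⟩ := h.shortExact
  rw [evx_iff] at *
  intro x
  obtain ⟨y, hy⟩ := Ext.contravariant_sequence_exact₂ hS W x (h2 _)
  rw [← hy, h1 y, Ext.comp_zero]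

theorem EVx.con1 (h : SES i p) (h1 : EVx.{w} n B W) (h2 : EVx.{w} (n+1) C W) : EVx.{w} n A W := by
  obtain ⟨w, hS⟩ := h.shortExact
  rw [evx_iff] at *
  intro x
  obtain ⟨y, hy⟩ := Ext.contravariant_sequence_exact₁ hS W x (n₁ := n+1+1) (by omega) (h2 _)
  rw [← hy, h1 y, Ext.comp_zero]

theorem EVx.con3 (h : SES i p) (h1 : EVx.{w} n A W) (h2 : EVx.{w} (n+1) B W) :
    EVx.{w} (n+1) C W := by
  obtain ⟨w, hS⟩ := h.shortExact
  rw [evx_iff] at *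
  intro x
  obtain ⟨y, hy⟩ := Ext.contravariant_sequence_exact₃ hS W x (h2 _) (n₀ := n+1) (by omega)
  rw [← hy, h1 y, Ext.comp_zero]

theorem EVx.cov0 (h : SES i p) (h1 : EVx.{w} 0 W B)
    (h2 : ∀ f : W ⟶ C, ∃ g : W ⟶ B, g ≫ p = f) : EVx.{w} 0 W A := by
  obtain ⟨w, hS⟩ := h.shortExact
  rw [evx_iff] at *
  intro x
  obtain ⟨y, hy⟩ := Ext.covariant_sequence_exact₁ W hS x (h1 _) (n₀ := 0) rfl
  obtain ⟨f, rfl⟩ := (Ext.mk₀_bijective _ _).2 y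
  obtain ⟨g, rfl⟩ := h2 f
  rw [← hy, ← Ext.mk₀_comp_mk₀, Ext.comp_assoc_of_second_deg_zero]
  erw [hS.comp_extClass]
  rw [Ext.comp_zero]

theorem EVx.con0 (h : SES i p) (h1 : EVx.{w} 0 B W)
    (h2 : ∀ f : A ⟶ W, ∃ g : B ⟶ W, i ≫ g = f) : EVx.{w} 0 C W := by
  obtain ⟨w, hS⟩ := h.shortExact
  rw [evx_iff] at *
  intro x
  obtain ⟨y, hy⟩ := Ext.contravariant_sequence_exact₃ hS W x (h1 _) (n₀ := 0) rfl
  obtain ⟨f, rfl⟩ := (Ext.mk₀_bijective _ _).2 y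
  obtain ⟨g, rfl⟩ := h2 f
  rw [← hy, ← Ext.mk₀_comp_mk₀]
  exact hS.extClass_comp_assoc _

theorem EVx.covh (h : SES i p) (h1 : EVx.{w} 0 W A) (f : W ⟶ C) : ∃ g : W ⟶ B, g ≫ p = f := by
  obtain ⟨w, hS⟩ := h.shortExact
  rw [evx_iff] at *
  obtain ⟨y, hy⟩ := Ext.covariant_sequence_exact₃ W hS (Ext.mk₀ f) (n₁ := 1) rfl (h1 _)
  obtain ⟨g, rfl⟩ := (Ext.mk₀_bijective _ _).2 y
  rw [Ext.mk₀_comp_mk₀] at hy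
  exact ⟨g, (Ext.mk₀_bijective _ _).1 hy⟩

theorem EVx.conh (h : SES i p) (h1 : EVx.{w} 0 C W) (f : A ⟶ W) : ∃ g : B ⟶ W, i ≫ g = f := by
  obtain ⟨w, hS⟩ := h.shortExact
  rw [evx_iff] at *
  obtain ⟨y, hy⟩ := Ext.contravariant_sequence_exact₁ hS W (Ext.mk₀ f) (n₁ := 1) rfl (h1 _)
  obtain ⟨g, rfl⟩ := (Ext.mk₀_bijective _ _).2 y
  rw [Ext.mk₀_comp_mk₀] at hy
  exact ⟨g, (Ext.mk₀_bijective _ _).1 hy⟩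

theorem EVx.retr_left {A B W : 𝒜} {n : ℕ} (h : Retr A B) (hB : EVx.{w} n B W) : EVx.{w} n A W := by
  obtain ⟨i, p, h⟩ := h
  rw [evx_iff] at *
  intro x
  rw [← Ext.mk₀_id_comp x, ← h, ← Ext.mk₀_comp_mk₀, Ext.comp_assoc_of_second_deg_zero,
    hB ((Ext.mk₀ p).comp x _), Ext.comp_zero]

theorem EVx.retr_right {A B W : 𝒜} {n : ℕ} (h : Retr A B) (hB : EVx.{w} n W B) :
    EVx.{w} n W A := by
  obtain ⟨i, p, h⟩ := h
  rw [evx_iff] at *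
  intro x
  rw [← Ext.comp_mk₀_id x, ← h, ← Ext.mk₀_comp_mk₀, ← Ext.comp_assoc_of_second_deg_zero,
    hB (x.comp (Ext.mk₀ i) _), Ext.zero_comp]

theorem EVx.proj {P Y : 𝒜} {n : ℕ} (h : Projective P) : EVx.{w} n P Y :=
  Ext.subsingleton_of_projective P Y n

theorem EVx.inj {P Y : 𝒜} {n : ℕ} (h : Injective P) : EVx.{w} n Y P :=
  Ext.subsingleton_of_injective _ _ _

theorem exact_of_mono {A B C D : 𝒜} {f : A ⟶ B} {g : B ⟶ C} {g' : B ⟶ D} (m : C ⟶ D) [Mono m]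
    (hm : g ≫ m = g') (w : f ≫ g = 0) (w' : f ≫ g' = 0) (h : (ShortComplex.mk f g' w').Exact) :
    (ShortComplex.mk f g w).Exact := by
  let φ : ShortComplex.mk f g w ⟶ ShortComplex.mk f g' w' :=
    { τ₁ := 𝟙 A, τ₂ := 𝟙 B, τ₃ := m, comm₁₂ := by simp, comm₂₃ := by simp [hm] }
  have : Epi φ.τ₁ := inferInstanceAs (Epi (𝟙 A))
  have : IsIso φ.τ₂ := inferInstanceAs (IsIso (𝟙 B))
  have : Mono φ.τ₃ := inferInstanceAs (Mono m)
  rwa [ShortComplex.exact_iff_of_epi_of_isIso_of_mono φ]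

theorem evx_of_res (Y : 𝒜) : ∀ (n : ℕ) (P : ℕ → 𝒜) (d : ∀ i, P (i+1) ⟶ P i) (X : 𝒜)
    (e : P 0 ⟶ X) (hP : ∀ i, Projective (P i)) (he : Epi e) (w0 : d 0 ≫ e = 0)
    (h0 : (ShortComplex.mk _ _ w0).Exact) (w : ∀ i, d (i+1) ≫ d i = 0)
    (hd : ∀ i, (ShortComplex.mk _ _ (w i)).Exact),
    EVx.{w} n X Y ↔ ∀ h : P (n+1) ⟶ Y, d (n+1) ≫ h = 0 → ∃ h', d n ≫ h' = h := by
  intro n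
  induction n with
  | zero =>
    intro P d X e hP he w0 h0 w hd
    let e' : P 1 ⟶ kernel e := kernel.lift e (d 0) w0
    have he' : Epi e' := h0.epi_kernelLift
    have he'd : e' ≫ kernel.ι e = d 0 := kernel.lift_ι _ _ _
    have w' : d 1 ≫ e' = 0 := by rw [← cancel_mono (kernel.ι e), Category.assoc, he'd, w, zero_comp]
    have hex : (ShortComplex.mk _ _ w').Exact := exact_of_mono (kernel.ι e) he'd _ _ (hd 0)
    constructor
    · intro h g hg
      obtain ⟨u, hu⟩ := EVx.conh (ses_kernel e) h (hex.desc g hg)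
      refine ⟨u, ?_⟩
      rw [← he'd, Category.assoc, hu]
      exact hex.g_desc g hg
    · intro h
      refine EVx.con0 (ses_kernel e) (EVx.proj (hP 0)) fun f => ?_
      obtain ⟨h', hh⟩ := h (e' ≫ f) (by rw [← Category.assoc]; erw [w']; rw [zero_comp])
      refine ⟨h', ?_⟩
      rw [← cancel_epi e', ← Category.assoc, he'd, hh]
  | succ n ih =>
    intro P d X e hP he w0 h0 w hd
    let e' : P 1 ⟶ kernel e := kernel.lift e (d 0) w0
    have he' : Epi e' := h0.epi_kernelLift
    have he'd : e' ≫ kernel.ι e = d 0 := kernel.lift_ι _ _ _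
    have w' : d 1 ≫ e' = 0 := by rw [← cancel_mono (kernel.ι e), Category.assoc, he'd, w, zero_comp]
    have hex : (ShortComplex.mk _ _ w').Exact := exact_of_mono (kernel.ι e) he'd _ _ (hd 0)
    rw [← ih (fun i => P (i+1)) (fun i => d (i+1)) (kernel e) e' (fun i => hP _) he' w' hex
      (fun i => w _) (fun i => hd _)]
    exact ⟨fun h => EVx.con1 (ses_kernel e) (EVx.proj (hP 0)) h,
      fun h => EVx.con3 (ses_kernel e) h (EVx.proj (hP 0))⟩
end extlem

section compare
variable {R : Type} [Ring R]

theorem extZero_iff (X Y : ModuleCat.{0} R) (n : ℕ) :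
    PS.ExtZero X Y (n+1) ↔ EVx.{0} n X Y := by
  have P : ProjectiveResolution X := Classical.choice HasProjectiveResolution.out
  have hd : ∀ i, (ShortComplex.mk (P.complex.d (i+2) (i+1)) (P.complex.d (i+1) i) (by simp)).Exact :=
    P.exact_succ
  have h0 := P.exact₀
  rw [evx_of_res Y n (fun i => P.complex.X i) (fun i => P.complex.d (i+1) i) X
    (P.π.f 0 ≫ (HomologicalComplex.singleObjXSelf _ _ _).hom) (fun i => P.projective i) inferInstance
    (by rw [← Category.assoc, P.complex_d_comp_π_f_zero, zero_comp]) ?_ (by simp) hd]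
  · have e := P.isoExt (R := ℤ) (n+1) Y
    have e1 : PS.ExtZero X Y (n+1) ↔ IsZero ((P.complex.linearYonedaObj ℤ Y).homology (n+1)) := by
      rw [← e.isZero_iff, ModuleCat.isZero_iff_subsingleton]
      rfl
    rw [e1, ← HomologicalComplex.exactAt_iff_isZero_homology,
      HomologicalComplex.exactAt_iff' _ n (n+1) (n+2) (by simp) (by simp),
      ShortComplex.moduleCat_exact_iff]
    rfl
  · exact exact_of_mono (HomologicalComplex.singleObjXSelf _ _ _).inv
      (by rw [Category.assoc, Iso.hom_inv_id, Category.comp_id]) _ _ h0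
end compare
end AbsTilt
end

section
open CategoryTheory CategoryTheory.Limits Opposite PS

set_option linter.all false

namespace AbsTilt

section bridge
variable {R : Type} [Ring R]

theorem ses_iff {A B C : ModuleCat.{0} R} (f : A ⟶ B) (g : B ⟶ C) :
    SES f g ↔ Function.Injective f.hom ∧ Function.Surjective g.hom ∧
      Function.Exact f.hom g.hom := by
  unfold SES
  rw [ModuleCat.mono_iff_injective, ModuleCat.epi_iff_surjective]
  refine and_congr Iff.rfl (and_congr Iff.rfl ⟨?_, ?_⟩)
  · rintro ⟨w, h⟩
    exact (ShortComplex.ShortExact.moduleCat_exact_iff_function_exact _).1 h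
  · intro h
    have w : f ≫ g = 0 := by
      ext x
      exact h.apply_apply_eq_zero x
    exact ⟨w, (ShortComplex.ShortExact.moduleCat_exact_iff_function_exact _).2 h⟩

theorem retr_iff {A B : ModuleCat.{0} R} : Retr A B ↔ IsSummand A B := by
  constructor
  · rintro ⟨i, p, h⟩
    exact ⟨i.hom, p.hom, by rw [← ModuleCat.hom_comp, h]; rfl⟩
  · rintro ⟨i, p, h⟩
    exact ⟨ModuleCat.ofHom i, ModuleCat.ofHom p, by rw [← ModuleCat.ofHom_comp, h]; rfl⟩

theorem isSum_prod (A B : ModuleCat.{0} R) : IsSum A B (ModuleCat.of R (A × B)) :=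
  ⟨ModuleCat.ofHom (LinearMap.inl R A B), ModuleCat.ofHom (LinearMap.fst R A B),
    ModuleCat.ofHom (LinearMap.inr R A B), ModuleCat.ofHom (LinearMap.snd R A B),
    by ext; simp, by ext; simp, by ext; simp, by ext; simp,
    by ext x <;> simp ⟩

theorem isSum_of_equiv {A B C : ModuleCat.{0} R} (e : C ≃ₗ[R] A × B) : IsSum A B C := by
  refine ⟨ModuleCat.ofHom (e.symm.toLinearMap ∘ₗ LinearMap.inl R A B),
    ModuleCat.ofHom (LinearMap.fst R A B ∘ₗ e.toLinearMap),
    ModuleCat.ofHom (e.symm.toLinearMap ∘ₗ LinearMap.inr R A B),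
    ModuleCat.ofHom (LinearMap.snd R A B ∘ₗ e.toLinearMap), ?_, ?_, ?_, ?_, ?_⟩
  · ext; simp
  · ext; simp
  · ext; simp
  · ext; simp
  · ext x
    simp [← map_add]

theorem pow_fin (X : ModuleCat.{0} R) : ∀ n : ℕ, Pow X (ModuleCat.of R (Fin n → X))
  | 0 => .zero (ModuleCat.isZero_of_subsingleton _)
  | n+1 => .sum (.self (Iso.refl X)) (pow_fin X n)
      (isSum_of_equiv (Fin.consLinearEquiv R (fun _ => X)).symm)

theorem isSummand_trans {A B C : ModuleCat.{0} R} (h : IsSummand A B) (h' : IsSummand B C) :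
    IsSummand A C := retr_iff.1 ((retr_iff.2 h).trans (retr_iff.2 h'))

theorem isSummand_of_equiv {A B : ModuleCat.{0} R} (e : A ≃ₗ[R] B) : IsSummand A B :=
  ⟨e.toLinearMap, e.symm.toLinearMap, by ext; simp⟩

theorem pow_memAdd {X A : ModuleCat.{0} R} (h : Pow X A) : MemAdd X A := by
  induction h with
  | zero h =>
    refine ⟨0, 0, 0, ?_⟩
    have := ModuleCat.subsingleton_of_isZero h
    ext; exact Subsingleton.elim _ _
  | @self A e =>
    exact ⟨1, isSummand_of_equiv (e.toLinearEquiv ≪≫ₗ (LinearEquiv.funUnique (Fin 1) R X).symm)⟩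
  | @sum A B C _ _ h h1 h2 =>
    obtain ⟨n, i, p, hip⟩ := h1
    obtain ⟨m, j, q, hjq⟩ := h2
    obtain ⟨i₁, p₁, i₂, p₂, e1, e2, e3, e4, e5⟩ := h
    let E : (Fin (n+m) → X) ≃ₗ[R] (Fin n → X) × (Fin m → X) :=
      (LinearEquiv.funCongrLeft R X finSumFinEquiv) ≪≫ₗ
        LinearEquiv.sumArrowLequivProdArrow (Fin n) (Fin m) R X
    refine ⟨n+m, E.symm.toLinearMap ∘ₗ ((i ∘ₗ p₁.hom).prod (j ∘ₗ p₂.hom)),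
      ((i₁.hom ∘ₗ p).coprod (i₂.hom ∘ₗ q)) ∘ₗ E.toLinearMap, ?_⟩
    have hip' : ∀ x, p (i x) = x := fun x => LinearMap.congr_fun hip x
    have hjq' : ∀ x, q (j x) = x := fun x => LinearMap.congr_fun hjq x
    ext x
    have := congrArg (fun f => f.hom x) e5
    simpa [hip', hjq'] using this

theorem add_iff {X A : ModuleCat.{0} R} : Add X A ↔ MemAdd X A := by
  constructor
  · rintro ⟨B, h1, h2⟩
    obtain ⟨n, h⟩ := pow_memAdd h1
    exact ⟨n, isSummand_trans (retr_iff.1 h2) h⟩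
  · rintro ⟨n, h⟩
    exact ⟨_, pow_fin X n, retr_iff.2 h⟩

theorem proj_iff {A : ModuleCat.{0} R} : Projective A ↔ Module.Projective R A :=
  (IsProjective.iff_projective A).symm

theorem inj_iff {A : ModuleCat.{0} R} : Injective A ↔ Module.Injective R A :=
  (Module.injective_iff_injective_object R A).symm

end bridge

section setup
variable (K : Type) [Field K] (R : Type) [Ring R] [Algebra K R] 

theorem dreg_smul_apply (s : R) (φ : Dreg K R) (r : R) :
    (show R →ₗ[K] K from s • φ) r = (show R →ₗ[K] K from φ) (r * s) := rfl

theorem smul_kMod (M : ModuleCat.{0} R) (c : K) (m : M) :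
    letI := kMod K M; c • m = algebraMap K R c • m := rfl

theorem kMod_tower (M : ModuleCat.{0} R) : letI := kMod K M; IsScalarTower K R M := by
  letI := kMod K M
  exact ⟨fun c r m => by rw [smul_kMod, Algebra.smul_def, mul_smul]⟩

/-- The map into `Dreg` determined by a functional. -/
def toDreg (M : ModuleCat.{0} R) (φ : letI := kMod K M; M →ₗ[K] K) : M →ₗ[R] Dreg K R :=
  letI := kMod K M
  { toFun := fun m => show R →ₗ[K] K from
      { toFun := fun r => φ (r • m)
        map_add' := fun r s => by rw [add_smul, map_add]
        map_smul' := fun c r => by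
          rw [Algebra.smul_def, mul_smul, RingHom.id_apply, ← map_smul]; rfl }
    map_add' := fun m m' => by
      refine LinearMap.ext fun r => ?_
      show φ _ = φ _ + φ _
      rw [smul_add, map_add]
    map_smul' := fun s m => by
      refine LinearMap.ext fun r => ?_
      show φ (r • s • m) = φ ((r * s) • m)
      rw [mul_smul] }

theorem toDreg_apply (M : ModuleCat.{0} R) (φ : letI := kMod K M; M →ₗ[K] K) (m : M) (r : R) :
    (show R →ₗ[K] K from toDreg K R M φ m) r = φ (r • m) := rfl

theorem dreg_injective : Module.Injective R (Dreg K R) := by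
  constructor
  intro X Y _ _ _ _ f hf g
  letI := kMod K (ModuleCat.of R X)
  letI := kMod K (ModuleCat.of R Y)
  letI : Module K X := kMod K (ModuleCat.of R X)
  letI : Module K Y := kMod K (ModuleCat.of R Y)
  let f' : X →ₗ[K] Y := { toFun := f, map_add' := map_add f, map_smul' := fun c x => map_smul f _ x }
  let ε : X →ₗ[K] K :=
    { toFun := fun x => (show R →ₗ[K] K from g x) 1
      map_add' := fun x y => by rw [map_add]; rfl
      map_smul' := fun c x => by
        have h1 : g (c • x) = algebraMap K R c • g x := map_smul g (algebraMap K R c) x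
        rw [h1]
        show (show R →ₗ[K] K from g x) (1 * algebraMap K R c) = _
        rw [one_mul, Algebra.algebraMap_eq_smul_one, map_smul]; rfl }
  obtain ⟨s, hs⟩ := f'.exists_leftInverse_of_injective (LinearMap.ker_eq_bot.2 hf)
  refine ⟨toDreg K R (ModuleCat.of R Y) (ε ∘ₗ s), fun x => ?_⟩
  refine LinearMap.ext fun r => ?_
  show ε (s (r • f x)) = _
  rw [← map_smul]
  have : s (f (r • x)) = r • x := LinearMap.congr_fun hs _
  rw [this]
  show (show R →ₗ[K] K from g (r • x)) 1 = _
  rw [map_smul]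
  show (show R →ₗ[K] K from g x) (1 * r) = _
  rw [one_mul]

variable {R}
variable [FiniteDimensional K R]

theorem kfin (M : ModuleCat.{0} R) (h : Module.Finite R M) :
    letI := kMod K M; Module.Finite K M := by
  letI := kMod K M
  haveI := kMod_tower K R M
  exact Module.Finite.trans R M

theorem rfin (M : ModuleCat.{0} R) (h : letI := kMod K M; Module.Finite K M) :
    Module.Finite R M := by
  letI := kMod K M
  haveI := kMod_tower K R M
  exact Module.Finite.of_restrictScalars_finite K R M

theorem dreg_finite : Module.Finite R (Dreg K R) := by
  apply rfin K
  letI := kMod K (Dreg K R)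
  let e : (R →ₗ[K] K) →ₗ[K] Dreg K R :=
    { toFun := fun φ => φ
      map_add' := fun _ _ => rfl
      map_smul' := fun c φ => by
        refine LinearMap.ext fun r => ?_
        show c • φ r = φ (r * algebraMap K R c)
        rw [← Algebra.commutes, ← Algebra.smul_def, map_smul] }
  exact Module.Finite.of_surjective e (fun x => ⟨x, rfl⟩)

theorem cogen_dreg (X : ModuleCat.{0} R) (h : Module.Finite R X) :
    ∃ (n : ℕ) (f : X →ₗ[R] (Fin n → Dreg K R)), Function.Injective f := by
  letI := kMod K X
  haveI := kfin K X h
  let b := Module.finBasis K X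
  refine ⟨_, LinearMap.pi fun i => toDreg K R X (b.coord i), ?_⟩
  rw [← LinearMap.ker_eq_bot, LinearMap.ker_eq_bot']
  intro m hm
  rw [← b.forall_coord_eq_zero_iff]
  intro i
  have h1 := congrArg (fun φ : Dreg K R => (show R →ₗ[K] K from φ) 1) (congrFun hm i)
  have h2 : b.coord i ((1 : R) • m) = 0 := h1
  rwa [one_smul] at h2

theorem hom_span (T X : ModuleCat.{0} R) (hT : Module.Finite R T) (hX : Module.Finite R X) :
    ∃ (n : ℕ) (φ : Fin n → (T →ₗ[R] X)), ∀ g : T →ₗ[R] X, ∃ c : Fin n → K,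
      ∀ t, g t = ∑ i, algebraMap K R (c i) • φ i t := by
  letI := kMod K T
  letI := kMod K X
  haveI := kfin K T hT
  haveI := kfin K X hX
  haveI := kMod_tower K R T
  haveI := kMod_tower K R X
  haveI := kMod_smulCommClass K X
  have hfin : Module.Finite K (T →ₗ[R] X) := by
    let e : (T →ₗ[R] X) →ₗ[K] (T →ₗ[K] X) :=
      { toFun := fun g => g.restrictScalars K
        map_add' := fun _ _ => rfl
        map_smul' := fun _ _ => rfl }
    exact Module.Finite.of_injective e (LinearMap.restrictScalars_injective K)
  let b := Module.finBasis K (T →ₗ[R] X)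
  refine ⟨_, b, fun g => ⟨b.repr g, fun t => ?_⟩⟩
  conv_lhs => rw [← b.sum_repr g]
  rw [LinearMap.sum_apply]
  rfl

theorem approx_aux (K : Type) [Field K] {R : Type} [Ring R] [Algebra K R]
    [FiniteDimensional K R] (T X : ModuleCat.{0} R) (hT : Module.Finite R T) (hX : Module.Finite R X) :
    ∃ (n : ℕ) (f : (Fin n → T) →ₗ[R] X), ∀ g : T →ₗ[R] X, ∃ h : T →ₗ[R] (Fin n → T),
      f ∘ₗ h = g := by
  obtain ⟨n, φ, h⟩ := hom_span K T X hT hX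
  letI := kMod K T
  haveI := kMod_smulCommClass K T
  refine ⟨n, LinearMap.lsum R (fun _ => T) ℕ φ, fun g => ?_⟩
  obtain ⟨c, hc⟩ := h g
  refine ⟨LinearMap.pi fun i => c i • LinearMap.id, ?_⟩
  ext t
  rw [hc]
  simp only [LinearMap.comp_apply, LinearMap.lsum_apply, LinearMap.sum_apply, LinearMap.proj_apply]
  refine Finset.sum_congr rfl fun i _ => ?_
  exact (φ i).map_smul _ t

theorem coapprox_aux (K : Type) [Field K] {R : Type} [Ring R] [Algebra K R]
    [FiniteDimensional K R] (T X : ModuleCat.{0} R) (hT : Module.Finite R T) (hX : Module.Finite R X) :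
    ∃ (n : ℕ) (f : X →ₗ[R] (Fin n → T)), ∀ g : X →ₗ[R] T, ∃ h : (Fin n → T) →ₗ[R] T,
      h ∘ₗ f = g := by
  obtain ⟨n, φ, h⟩ := hom_span K X T hX hT
  letI := kMod K T
  haveI := kMod_smulCommClass K T
  refine ⟨n, LinearMap.pi φ, fun g => ?_⟩
  obtain ⟨c, hc⟩ := h g
  refine ⟨LinearMap.lsum R (fun _ => T) ℕ fun i => c i • LinearMap.id, ?_⟩
  ext t
  rw [hc]
  simp only [LinearMap.comp_apply, LinearMap.lsum_apply, LinearMap.sum_apply, LinearMap.proj_apply]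
  rfl

theorem noeth (K : Type) [Field K] (R : Type) [Ring R] [Algebra K R]
    [FiniteDimensional K R] : IsNoetherianRing R := isNoetherian_of_tower K inferInstance

/-- The concrete setup. -/
noncomputable def modSetup : Setup (ModuleCat.{0} R) where
  fin M := Module.Finite R M
  EV n X Y := EVx.{0} n X Y
  G := reg R
  J := Dreg K R
  fin_mono f hf h := by
    haveI := noeth K R
    exact Module.Finite.of_injective f.hom ((ModuleCat.mono_iff_injective f).1 hf)
  fin_epi f hf h := Module.Finite.of_surjective f.hom ((ModuleCat.epi_iff_surjective f).1 hf)
  fin_sum {A B} h1 h2 :=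
    Module.Finite.equiv (ModuleCat.biprodIsoProd A B).toLinearEquiv.symm
  fin_G := Module.Finite.self R
  fin_J := dreg_finite K
  proj_G := proj_iff.2 (Module.Projective.of_free (R := R) (P := R))
  inj_J := inj_iff.2 (dreg_injective K R)
  gen_G {X} h := by
    obtain ⟨n, f, hf⟩ := Module.Finite.exists_fin' R X
    exact ⟨ModuleCat.of R (Fin n → reg R), ModuleCat.ofHom f, (pow_fin _ n).add,
      (ModuleCat.epi_iff_surjective _).2 hf⟩
  cogen_J {X} h := by
    obtain ⟨n, f, hf⟩ := cogen_dreg K X h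
    exact ⟨ModuleCat.of R (Fin n → Dreg K R), ModuleCat.ofHom f, (pow_fin _ n).add,
      (ModuleCat.mono_iff_injective _).2 hf⟩
  approx {T X} hT hX := by
    obtain ⟨n, f, hf⟩ := approx_aux K T X hT hX
    refine ⟨_, ModuleCat.ofHom f, pow_fin _ n, fun g => ?_⟩
    obtain ⟨h, hh⟩ := hf g.hom
    exact ⟨ModuleCat.ofHom h, by ext x; exact LinearMap.congr_fun hh x⟩
  coapprox {T X} hT hX := by
    obtain ⟨n, f, hf⟩ := coapprox_aux K T X hT hX
    refine ⟨_, ModuleCat.ofHom f, pow_fin _ n, fun g => ?_⟩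
    obtain ⟨h, hh⟩ := hf g.hom
    exact ⟨ModuleCat.ofHom h, by ext x; exact LinearMap.congr_fun hh x⟩
  ev_proj := EVx.proj
  ev_inj := EVx.inj
  cov2 := EVx.cov2
  cov3 := EVx.cov3
  cov1 := EVx.cov1
  con2 := EVx.con2
  con1 := EVx.con1
  con3 := EVx.con3
  cov0 := EVx.cov0
  con0 := EVx.con0
  covh := EVx.covh
  conh := EVx.conh
  ev_retr_left := EVx.retr_left
  ev_retr_right := EVx.retr_right

end setup
end AbsTilt
end

section
open CategoryTheory CategoryTheory.Limits Opposite PS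

set_option linter.all false

namespace AbsTilt

section seqs
variable {R : Type} [Ring R]

/-- Prepend an object. -/
def consY (L : ModuleCat.{0} R) (Y : ℕ → ModuleCat.{0} R) : ℕ → ModuleCat.{0} R
  | 0 => L
  | i+1 => Y i

/-- Prepend a map. -/
def consf (L : ModuleCat.{0} R) (Y : ℕ → ModuleCat.{0} R) (g : L →ₗ[R] Y 0)
    (f : ∀ i, Y i →ₗ[R] Y (i+1)) : ∀ i, consY L Y i →ₗ[R] consY L Y (i+1)
  | 0 => g
  | i+1 => f i

/-- Prepend a map, descending version. -/
def consd (L : ModuleCat.{0} R) (Y : ℕ → ModuleCat.{0} R) (g : Y 0 →ₗ[R] L)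
    (f : ∀ i, Y (i+1) →ₗ[R] Y i) : ∀ i, consY L Y (i+1) →ₗ[R] consY L Y i
  | 0 => g
  | i+1 => f i

variable {X Z : ModuleCat.{0} R → Prop}

theorem exact_range {A B C : ModuleCat.{0} R} {f : A →ₗ[R] B} {g : B →ₗ[R] C}
    (h : Function.Exact f g) : Function.Exact f g.rangeRestrict := by
  intro x
  rw [← h x, ← Subtype.coe_inj]
  rfl

theorem exact_subtype {B C D : ModuleCat.{0} R} {f : B →ₗ[R] C} {g : C →ₗ[R] D}
    (h : Function.Exact f g) : Function.Exact (LinearMap.range f).subtype g := by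
  intro x
  rw [h x]
  simp

theorem rres_of_seq (hZ : ∀ A B : ModuleCat.{0} R, (A ≃ₗ[R] B) → Z B → Z A) :
    ∀ (k : ℕ) (Y : ℕ → ModuleCat.{0} R) (f : ∀ i, Y i →ₗ[R] Y (i+1)),
    IsExactSeq (k+1) Y f → (∀ i, 1 ≤ i → i ≤ k → X (Y i)) → Z (Y (k+1)) → RRes X Z k (Y 0) := by
  intro k
  induction k with
  | zero =>
    intro Y f h _ hz
    exact hZ _ _ (LinearEquiv.ofBijective (f 0) ⟨h.1, h.2.1⟩) hz
  | succ k ih =>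
    intro Y f ⟨h1, h2, h3⟩ hx hz
    refine ⟨Y 1, ModuleCat.of R (LinearMap.range (f 1)), ModuleCat.ofHom (f 0),
      ModuleCat.ofHom (f 1).rangeRestrict, (ses_iff _ _).2 ⟨h1, LinearMap.surjective_rangeRestrict _,
        exact_range (h3 0 (by omega))⟩, hx 1 le_rfl (by omega), ?_⟩
    refine ih (consY (ModuleCat.of R (LinearMap.range (f 1))) (fun i => Y (i+2)))
      (consf _ _ (LinearMap.range (f 1)).subtype (fun i => f (i+2))) ⟨?_, ?_, ?_⟩ ?_ hz
    · exact Subtype.val_injective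
    · cases k with
      | zero =>
        intro x
        obtain ⟨y, hy⟩ := h2 x
        exact ⟨⟨x, y, hy⟩, rfl⟩
      | succ k => exact h2
    · intro i hi
      cases i with
      | zero => exact exact_subtype (h3 1 (by omega))
      | succ i => exact h3 (i+2) (by omega)
    · intro i h1 h2
      obtain ⟨i, rfl⟩ : ∃ j, i = j + 1 := ⟨i-1, by omega⟩
      exact hx (i+2) (by omega) (by omega)

theorem cogen_of_seq :
    ∀ (k : ℕ) (Y : ℕ → ModuleCat.{0} R) (f : ∀ i, Y i →ₗ[R] Y (i+1)),
    Function.Injective (f 0) → (∀ i, i < k → Function.Exact (f i) (f (i+1))) →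
    (∀ i, 1 ≤ i → i ≤ k+1 → X (Y i)) → RRes X (fun _ => True) (k+1) (Y 0) := by
  intro k
  induction k with
  | zero =>
    intro Y f h _ hx
    refine ⟨Y 1, ModuleCat.of R (Y 1 ⧸ LinearMap.range (f 0)), ModuleCat.ofHom (f 0),
      ModuleCat.ofHom (LinearMap.range (f 0)).mkQ, (ses_iff _ _).2 ⟨h, Submodule.mkQ_surjective _,
        LinearMap.exact_map_mkQ_range _⟩, hx 1 le_rfl (by omega), trivial⟩
  | succ k ih =>
    intro Y f h1 h3 hx
    refine ⟨Y 1, ModuleCat.of R (LinearMap.range (f 1)), ModuleCat.ofHom (f 0),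
      ModuleCat.ofHom (f 1).rangeRestrict, (ses_iff _ _).2 ⟨h1, LinearMap.surjective_rangeRestrict _,
        exact_range (h3 0 (by omega))⟩, hx 1 le_rfl (by omega), ?_⟩
    refine ih (consY (ModuleCat.of R (LinearMap.range (f 1))) (fun i => Y (i+2)))
      (consf _ _ (LinearMap.range (f 1)).subtype (fun i => f (i+2))) ?_ ?_ ?_
    · exact Subtype.val_injective
    · intro i hi
      cases i with
      | zero => exact exact_subtype (h3 1 (by omega))
      | succ i => exact h3 (i+2) (by omega)
    · intro i h1 h2
      obtain ⟨i, rfl⟩ : ∃ j, i = j + 1 := ⟨i-1, by omega⟩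
      exact hx (i+2) (by omega) (by omega)

theorem exact_comp_left {A B C D : ModuleCat.{0} R} {i : A →ₗ[R] B} {p : B →ₗ[R] C}
    {j : C →ₗ[R] D} (h : Function.Exact i p) (hj : Function.Injective j) :
    Function.Exact i (j ∘ₗ p) := by
  intro x
  rw [← h x]
  exact map_eq_zero_iff j hj

theorem exact_comp_right {A B C D : ModuleCat.{0} R} {p : A →ₗ[R] B} {j : B →ₗ[R] C}
    {q : C →ₗ[R] D} (h : Function.Exact j q) (hp : Function.Surjective p) :
    Function.Exact (j ∘ₗ p) q := by
  intro x
  rw [h x]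
  constructor
  · rintro ⟨y, rfl⟩
    obtain ⟨z, rfl⟩ := hp y
    exact ⟨z, rfl⟩
  · rintro ⟨z, rfl⟩
    exact ⟨p z, rfl⟩

theorem seq_of_rres : ∀ (k : ℕ) (M : ModuleCat.{0} R), RRes X Z k M →
    ∃ (Y : ℕ → ModuleCat.{0} R) (f : ∀ i, Y i →ₗ[R] Y (i+1)),
      IsExactSeq (k+1) Y f ∧ Y 0 = M ∧ (∀ i, 1 ≤ i → i ≤ k → X (Y i)) ∧ Z (Y (k+1)) := by
  intro k
  induction k with
  | zero =>
    intro M h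
    exact ⟨fun _ => M, fun _ => LinearMap.id, ⟨Function.injective_id, Function.surjective_id,
      fun i hi => by omega⟩, rfl, fun i h1 h2 => by omega, h⟩
  | succ k ih =>
    rintro M ⟨P, L, i, p, hs, hx, hr⟩
    obtain ⟨Y, f, ⟨h1, h2, h3⟩, h4, h5, h6⟩ := ih L hr
    subst h4
    obtain ⟨s1, s2, s3⟩ := (ses_iff _ _).1 hs
    refine ⟨consY M (consY P (fun i => Y (i+1))),
      consf _ _ i.hom (consf P (fun i => Y (i+1)) (f 0 ∘ₗ p.hom) (fun i => f (i+1))),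
      ⟨s1, ?_, ?_⟩, rfl, ?_, h6⟩
    · cases k with
      | zero =>
        have h : Function.Surjective (f 0 ∘ₗ p.hom) := by
          rw [LinearMap.coe_comp]; exact Function.Surjective.comp h2 s2
        exact h
      | succ k => exact h2
    · intro j hj
      cases j with
      | zero => exact exact_comp_left s3 h1
      | succ j =>
        cases j with
        | zero => exact exact_comp_right (h3 0 (by omega)) s2
        | succ j => exact h3 (j+1) (by omega)
    · intro j hj1 hj2
      obtain ⟨j, rfl⟩ : ∃ l, j = l + 1 := ⟨j-1, by omega⟩
      cases j with
      | zero => exact hx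
      | succ j => exact h5 (j+1) (by omega) (by omega)

/-- Auxiliary end condition. -/
def GoodL (Y : ℕ → ModuleCat.{0} R) (f : ∀ i, Y i →ₗ[R] Y (i+1)) :
    ∀ (k : ℕ) (M : ModuleCat.{0} R), (Y k →ₗ[R] M) → Prop
  | 0, M, g => Function.Bijective g
  | k+1, M, g => Function.Surjective g ∧ Function.Exact (f k) g

theorem lres_of_good (hZ : ∀ A B : ModuleCat.{0} R, (A ≃ₗ[R] B) → Z B → Z A)
    (Y : ℕ → ModuleCat.{0} R) (f : ∀ i, Y i →ₗ[R] Y (i+1)) (h0 : Function.Injective (f 0))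
    (hz : Z (Y 0)) :
    ∀ (k : ℕ) (M : ModuleCat.{0} R) (g : Y k →ₗ[R] M), GoodL Y f k M g →
    (∀ i, i + 2 ≤ k → Function.Exact (f i) (f (i+1))) →
    (∀ i, 1 ≤ i → i ≤ k → X (Y i)) → LRes X Z k M := by
  intro k
  induction k with
  | zero =>
    intro M g h _ _
    exact hZ _ _ (LinearEquiv.ofBijective g h).symm hz
  | succ k ih =>
    rintro M g ⟨h1, h2⟩ h3 hx
    refine ⟨ModuleCat.of R (LinearMap.ker g), Y (k+1), ModuleCat.ofHom (LinearMap.ker g).subtype,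
      ModuleCat.ofHom g, (ses_iff _ _).2 ⟨Subtype.val_injective, h1,
        LinearMap.exact_subtype_ker_map g⟩, hx _ (by omega) le_rfl, ?_⟩
    have hc : ∀ x, f k x ∈ LinearMap.ker g := fun x => h2.apply_apply_eq_zero x
    have hs : Function.Surjective (LinearMap.codRestrict (LinearMap.ker g) (f k) hc) := by
      rintro ⟨x, hxx⟩
      obtain ⟨y, hy⟩ := (h2 x).1 hxx
      exact ⟨y, Subtype.ext hy⟩
    refine ih (ModuleCat.of R (LinearMap.ker g)) (LinearMap.codRestrict _ (f k) hc) ?_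
      (fun i hi => h3 i (by omega)) (fun i h1 h2 => hx i h1 (by omega))
    cases k with
    | zero =>
      refine ⟨fun a b hab => h0 (congrArg Subtype.val hab), hs⟩
    | succ k =>
      refine ⟨hs, fun x => ?_⟩
      rw [← h3 k (by omega) x, ← Subtype.coe_inj]
      rfl

theorem lres_of_seq (hZ : ∀ A B : ModuleCat.{0} R, (A ≃ₗ[R] B) → Z B → Z A)
    (k : ℕ) (Y : ℕ → ModuleCat.{0} R) (f : ∀ i, Y i →ₗ[R] Y (i+1))
    (h : IsExactSeq (k+1) Y f) (hx : ∀ i, 1 ≤ i → i ≤ k → X (Y i)) (hz : Z (Y 0)) :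
    LRes X Z k (Y (k+1)) := by
  obtain ⟨h1, h2, h3⟩ := h
  refine lres_of_good hZ Y f h1 hz k _ (f k) ?_ (fun i hi => h3 i (by omega)) hx
  cases k with
  | zero => exact ⟨h1, h2⟩
  | succ k => exact ⟨h2, h3 k (by omega)⟩

theorem gen_of_seq (k : ℕ) (Y : ℕ → ModuleCat.{0} R) (f : ∀ i, Y i →ₗ[R] Y (i+1))
    (hx : ∀ i, i ≤ k → X (Y i)) (h1 : Function.Surjective (f k))
    (h2 : ∀ i, i < k → Function.Exact (f i) (f (i+1))) :
    LRes X (fun _ => True) (k+1) (Y (k+1)) := by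
  refine lres_of_seq (Z := fun _ => True) (fun _ _ _ _ => trivial) (k+1)
    (consY (ModuleCat.of R (LinearMap.ker (f 0))) Y)
    (consf _ _ (LinearMap.ker (f 0)).subtype f) ⟨Subtype.val_injective, h1, ?_⟩ ?_ trivial
  · intro i hi
    cases i with
    | zero => exact LinearMap.exact_subtype_ker_map _
    | succ i => exact h2 i (by omega)
  · intro i h1 h2
    obtain ⟨i, rfl⟩ : ∃ l, i = l + 1 := ⟨i-1, by omega⟩
    exact hx i (by omega)

theorem chain_of_lres : ∀ (k : ℕ) (M : ModuleCat.{0} R), LRes X Z k M →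
    ∃ (Y : ℕ → ModuleCat.{0} R) (f : ∀ i, Y (i+1) →ₗ[R] Y i),
      Function.Surjective (f 0) ∧ Function.Injective (f k) ∧
      (∀ i, i < k → Function.Exact (f (i+1)) (f i)) ∧
      Y 0 = M ∧ (∀ i, 1 ≤ i → i ≤ k → X (Y i)) ∧ Z (Y (k+1)) := by
  intro k
  induction k with
  | zero =>
    intro M h
    exact ⟨fun _ => M, fun _ => LinearMap.id, Function.surjective_id, Function.injective_id,
      fun i hi => by omega, rfl, fun i h1 h2 => by omega, h⟩
  | succ k ih =>
    rintro M ⟨L, P, i, p, hs, hx, hr⟩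
    obtain ⟨Y, f, h1, h2, h3, h4, h5, h6⟩ := ih L hr
    subst h4
    obtain ⟨s1, s2, s3⟩ := (ses_iff _ _).1 hs
    refine ⟨consY M (consY P (fun i => Y (i+1))),
      consd _ _ p.hom (consd P (fun i => Y (i+1)) (i.hom ∘ₗ f 0) (fun i => f (i+1))),
      s2, ?_, ?_, rfl, ?_, h6⟩
    · cases k with
      | zero =>
        have h : Function.Injective (i.hom ∘ₗ f 0) := by
          rw [LinearMap.coe_comp]; exact Function.Injective.comp s1 h2
        exact h
      | succ k => exact h2
    · intro j hj
      cases j with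
      | zero => exact exact_comp_right s3 h1
      | succ j =>
        cases j with
        | zero => exact exact_comp_left (h3 0 (by omega)) s1
        | succ j => exact h3 (j+1) (by omega)
    · intro j hj1 hj2
      obtain ⟨j, rfl⟩ : ∃ l, j = l + 1 := ⟨j-1, by omega⟩
      cases j with
      | zero => exact hx
      | succ j => exact h5 (j+1) (by omega) (by omega)

/-- All differentials. -/
def dd (Y : ℕ → ModuleCat.{0} R) (f : ∀ i, Y (i+1) →ₗ[R] Y i) (i j : ℕ) : Y i →ₗ[R] Y j :=
  if h : i = j + 1 then by subst h; exact f j else 0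

theorem dd_succ (Y : ℕ → ModuleCat.{0} R) (f : ∀ i, Y (i+1) →ₗ[R] Y i) (j : ℕ) :
    dd Y f (j+1) j = f j := by
  simp [dd]

theorem seq_of_lres (k : ℕ) (M : ModuleCat.{0} R) (h : LRes X Z k M) :
    ∃ (Y : ℕ → ModuleCat.{0} R) (f : ∀ i, Y i →ₗ[R] Y (i+1)),
      IsExactSeq (k+1) Y f ∧ Y (k+1) = M ∧ (∀ i, 1 ≤ i → i ≤ k → X (Y i)) ∧ Z (Y 0) := by
  obtain ⟨Y, f, h1, h2, h3, h4, h5, h6⟩ := chain_of_lres k M h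
  refine ⟨fun i => Y (k+1-i), fun i => dd Y f (k+1-i) (k+1-(i+1)), ⟨?_, ?_, ?_⟩, ?_, ?_, h6⟩
  · show Function.Injective (dd Y f (k+1-0) (k+1-1))
    rw [show k+1-0 = k+1 by omega, show k+1-1 = k by omega, dd_succ]
    exact h2
  · show Function.Surjective (dd Y f (k+1-(k+1-1)) (k+1-(k+1-1+1)))
    rw [show k+1-(k+1-1) = 0+1 by omega, show k+1-(k+1-1+1) = 0 by omega, dd_succ]
    exact h1
  · intro i hi
    show Function.Exact (dd Y f (k+1-i) (k+1-(i+1))) (dd Y f (k+1-(i+1)) (k+1-(i+1+1)))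
    obtain ⟨a, ha⟩ : ∃ a, k+1 = a + i + 2 := ⟨k+1-(i+2), by omega⟩
    rw [show k+1-i = a+1+1 by omega, show k+1-(i+1) = a+1 by omega,
      show k+1-(i+1+1) = a by omega, dd_succ, dd_succ]
    exact h3 a (by omega)
  · show Y (k+1-(k+1)) = M
    rw [Nat.sub_self, h4]
  · intro i hi1 hi2
    exact h5 _ (by omega) (by omega)

theorem memGen_of_lres (k : ℕ) (Q M : ModuleCat.{0} R) (h : Gen (k+1) Q M) : MemGen k Q M := by
  obtain ⟨Y, f, ⟨h1, h2, h3⟩, h4, h5, -⟩ := seq_of_lres _ _ h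
  subst h4
  exact ⟨fun i => Y (i+1), fun i => f (i+1), fun i hi => add_iff.1 (h5 _ (by omega) (by omega)),
    rfl, h2, fun i hi => h3 _ (by omega)⟩

theorem memGenShift_iff (k : ℕ) (Q M : ModuleCat.{0} R) : MemGenShift k Q M ↔ Gen k Q M := by
  cases k with
  | zero => exact Iff.rfl
  | succ k =>
    refine ⟨?_, memGen_of_lres k Q M⟩
    rintro ⟨Y, f, h1, h2, h3, h4⟩
    subst h2
    exact gen_of_seq k Y f (fun i hi => add_iff.2 (h1 i hi)) h3 h4

theorem memCogenShift_iff (k : ℕ) (Q M : ModuleCat.{0} R) :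
    MemCogenShift k Q M ↔ Cogen k Q M := by
  cases k with
  | zero => exact Iff.rfl
  | succ k =>
    refine ⟨?_, ?_⟩
    · rintro ⟨Y, f, h1, h2, h3, h4⟩
      subst h2
      exact cogen_of_seq k Y f h3 h4 (fun i hi hi' => add_iff.2 (h1 i hi hi'))
    · intro h
      obtain ⟨Y, f, ⟨h1, h2, h3⟩, h4, h5, -⟩ := seq_of_rres _ _ h
      exact ⟨Y, f, fun i hi hi' => add_iff.1 (h5 i hi hi'), h4, h1, fun i hi => h3 i (by omega)⟩

theorem isoClosed_proj (A B : ModuleCat.{0} R) (e : A ≃ₗ[R] B) (h : Projective B) :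
    Projective A := (retr_iff.2 (isSummand_of_equiv e)).projective h

theorem isoClosed_inj (A B : ModuleCat.{0} R) (e : A ≃ₗ[R] B) (h : Injective B) :
    Injective A := (retr_iff.2 (isSummand_of_equiv e)).injective h

theorem isoClosed_add (T A B : ModuleCat.{0} R) (e : A ≃ₗ[R] B) (h : Add T B) :
    Add T A := h.retr (retr_iff.2 (isSummand_of_equiv e))

theorem pdimLE_iff (k : ℕ) (M : ModuleCat.{0} R) :
    PdimLE k M ↔ LRes Projective Projective k M := by
  constructor
  · rintro ⟨Y, f, h1, h2, h3⟩
    subst h3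
    exact lres_of_seq isoClosed_proj k Y f h1 (fun i _ h => proj_iff.2 (h2 i h))
      (proj_iff.2 (h2 0 (by omega)))
  · intro h
    obtain ⟨Y, f, h1, h2, h3, h4⟩ := seq_of_lres _ _ h
    refine ⟨Y, f, h1, fun i hi => ?_, h2⟩
    rw [← proj_iff]
    rcases Nat.eq_zero_or_pos i with rfl | hi'
    · exact h4
    · exact h3 i hi' hi

theorem idimLE_iff (k : ℕ) (M : ModuleCat.{0} R) :
    IdimLE k M ↔ RRes Injective Injective k M := by
  constructor
  · rintro ⟨Y, f, h1, h2, h3⟩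
    subst h3
    exact rres_of_seq isoClosed_inj k Y f h1 (fun i h h' => inj_iff.2 (h2 i h (by omega)))
      (inj_iff.2 (h2 _ (by omega) le_rfl))
  · intro h
    obtain ⟨Y, f, h1, h2, h3, h4⟩ := seq_of_rres _ _ h
    refine ⟨Y, f, h1, fun i hi hi' => ?_, h2⟩
    rw [← inj_iff]
    rcases Nat.lt_or_ge k i with hk | hk
    · obtain rfl : i = k + 1 := by omega
      exact h4
    · exact h3 i hi hk

theorem extVanishing_iff (M N : ModuleCat.{0} R) : ExtVanishing M N ↔ ∀ n, EVx.{0} n M N := by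
  constructor
  · intro h n
    exact (extZero_iff _ _ _).1 (h (n+1) (by omega))
  · intro h n hn
    obtain ⟨n, rfl⟩ : ∃ l, n = l + 1 := ⟨n-1, by omega⟩
    exact (extZero_iff _ _ _).2 (h n)

end seqs

section tilt
variable (K : Type) [Field K] {R : Type} [Ring R] [Algebra K R] [FiniteDimensional K R]

theorem isTilting_iff (k : ℕ) (T : ModuleCat.{0} R) :
    IsTilting k T ↔ (modSetup K (R := R)).Tilt k T := by
  refine and_congr Iff.rfl (and_congr (pdimLE_iff k T) (and_congr (extVanishing_iff T T) ?_))
  constructor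
  · rintro ⟨Y, f, h1, h2, h3⟩
    show RRes (Add T) (Add T) k (reg R)
    rw [← h2]
    exact rres_of_seq (isoClosed_add T) k Y f h1 (fun i h h' => add_iff.2 (h3 i h (by omega)))
      (add_iff.2 (h3 _ (by omega) le_rfl))
  · intro h
    obtain ⟨Y, f, h1, h2, h3, h4⟩ := seq_of_rres _ _ h
    refine ⟨Y, f, h1, h2, fun i hi hi' => ?_⟩
    rw [← add_iff]
    rcases Nat.lt_or_ge k i with hk | hk
    · obtain rfl : i = k + 1 := by omega
      exact h4
    · exact h3 i hi hk

theorem isCotilting_iff (k : ℕ) (T : ModuleCat.{0} R) :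
    IsCotilting K k T ↔ (modSetup K (R := R)).Cotilt k T := by
  refine and_congr Iff.rfl (and_congr (idimLE_iff k T) (and_congr (extVanishing_iff T T) ?_))
  constructor
  · rintro ⟨Y, f, h1, h2, h3⟩
    show LRes (Add T) (Add T) k (Dreg K R)
    rw [← h2]
    exact lres_of_seq (isoClosed_add T) k Y f h1 (fun i h h' => add_iff.2 (h3 i (by omega)))
      (add_iff.2 (h3 _ (by omega)))
  · intro h
    obtain ⟨Y, f, h1, h2, h3, h4⟩ := seq_of_lres _ _ h
    refine ⟨Y, f, h1, h2, fun i hi => ?_⟩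
    rw [← add_iff]
    rcases Nat.eq_zero_or_pos i with rfl | hi'
    · exact h4
    · exact h3 i hi' hi

theorem special_tilting (P : ModuleCat.{0} R) (k : ℕ) (T : ModuleCat.{0} R)
    (h : IsSpecialTilting P k T) : RRes (Add P) (Add T) k (reg R) := by
  obtain ⟨-, Y, f, h1, h2, h3, h4⟩ := h
  rw [← h2]
  exact rres_of_seq (isoClosed_add T) k Y f h1 (fun i h h' => add_iff.2 (h4 i h h'))
    (add_iff.2 (h3 _ (by omega) le_rfl))

theorem special_cotilting (P : ModuleCat.{0} R) (k : ℕ) (T : ModuleCat.{0} R)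
    (h : IsSpecialCotilting K P k T) : LRes (Add P) (Add T) k (Dreg K R) := by
  obtain ⟨-, Y, f, h1, h2, h3, h4⟩ := h
  rw [← h2]
  exact lres_of_seq (isoClosed_add T) k Y f h1 (fun i h h' => add_iff.2 (h4 i h h'))
    (add_iff.2 (h3 _ (by omega)))

end tilt
end AbsTilt
end

section
open CategoryTheory CategoryTheory.Limits Opposite PS

set_option linter.all false

namespace AbsTilt

section ks
variable {R : Type} [Ring R]

theorem summand_compl {A B : ModuleCat.{0} R} (h : IsSummand A B) :
    ∃ C : ModuleCat.{0} R, Nonempty (B ≃ₗ[R] A × C) := by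
  obtain ⟨i, p, h⟩ := h
  have h' : ∀ x, p (i x) = x := fun x => LinearMap.congr_fun h x
  refine ⟨ModuleCat.of R (LinearMap.ker p), ⟨LinearEquiv.ofBijective
    (p.prod (LinearMap.codRestrict (LinearMap.ker p) (LinearMap.id - i ∘ₗ p) ?_)) ⟨?_, ?_⟩⟩⟩
  · intro x
    simp [h']
  · rw [← LinearMap.ker_eq_bot, LinearMap.ker_eq_bot']
    intro x hx
    have h1 : p x = 0 := congrArg Prod.fst hx
    have h2 : x - i (p x) = 0 := congrArg (fun y => (Prod.snd y : LinearMap.ker p).1) hx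
    rw [h1, map_zero, sub_zero] at h2
    exact h2
  · rintro ⟨a, c, hc⟩
    have hc' : p c = 0 := hc
    refine ⟨i a + c, Prod.ext ?_ (Subtype.ext ?_)⟩
    · show p (i a + c) = a
      rw [map_add, h', hc', add_zero]
    · show i a + c - i (p (i a + c)) = c
      rw [map_add, h', hc', add_zero]
      abel

theorem summand_fst (A C : ModuleCat.{0} R) : IsSummand A (ModuleCat.of R (A × C)) :=
  ⟨LinearMap.inl R A C, LinearMap.fst R A C, by ext; simp⟩

theorem summand_snd (A C : ModuleCat.{0} R) : IsSummand C (ModuleCat.of R (A × C)) :=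
  ⟨LinearMap.inr R A C, LinearMap.snd R A C, by ext; simp⟩

theorem summand_prod {A B A' B' : ModuleCat.{0} R} (h : IsSummand A A') (h' : IsSummand B B') :
    IsSummand (ModuleCat.of R (A × B)) (ModuleCat.of R (A' × B')) := by
  obtain ⟨i, p, h⟩ := h
  obtain ⟨j, q, h'⟩ := h'
  refine ⟨i.prodMap j, p.prodMap q, ?_⟩
  exact LinearMap.ext fun x => Prod.ext (LinearMap.congr_fun h x.1) (LinearMap.congr_fun h' x.2)

theorem summand_refl (A : ModuleCat.{0} R) : IsSummand A A := isSummand_of_equiv (.refl R A)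

theorem summand_of_subsingleton {A B : ModuleCat.{0} R} (h : Subsingleton A) : IsSummand A B :=
  ⟨0, 0, by ext; exact Subsingleton.elim _ _⟩

theorem memAdd_summand {X A B : ModuleCat.{0} R} (h : MemAdd X B) (h' : IsSummand A B) :
    MemAdd X A := by
  obtain ⟨n, h⟩ := h
  exact ⟨n, isSummand_trans h' h⟩

theorem basic_summand {A B : ModuleCat.{0} R} (h : IsBasic B) (h' : IsSummand A B) : IsBasic A :=
  fun X hX => h X (isSummand_trans hX h')

/-- Indecomposable modules. -/
def Indec (X : ModuleCat.{0} R) : Prop :=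
  Nontrivial X ∧ ∀ p q : Submodule R X, IsCompl p q → p = ⊥ ∨ q = ⊥

/-- Length as a natural number. -/
noncomputable def len (X : ModuleCat.{0} R) : ℕ := (Module.length R X).toNat

variable [IsArtinianRing R] [IsNoetherianRing R]

theorem len_prod {A B C : ModuleCat.{0} R} (e : C ≃ₗ[R] A × B) (hC : Module.Finite R C) :
    len C = len A + len B := by
  haveI : Module.Finite R (A × B) := Module.Finite.equiv e
  haveI : Module.Finite R A := Module.Finite.of_surjective (LinearMap.fst R A B)
    LinearMap.fst_surjective
  haveI : Module.Finite R B := Module.Finite.of_surjective (LinearMap.snd R A B)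
    LinearMap.snd_surjective
  unfold len
  rw [e.length_eq, Module.length_prod, ENat.toNat_add Module.length_ne_top Module.length_ne_top]

theorem len_pos {A : ModuleCat.{0} R} (hA : Module.Finite R A) (h : Nontrivial A) : 0 < len A := by
  have h1 := Module.length_pos (R := R) (M := A)
  have h2 := Module.length_ne_top (R := R) (M := A)
  unfold len
  rw [Nat.pos_iff_ne_zero]
  intro h
  rcases ENat.toNat_eq_zero.1 h with h | h
  · exact h1.ne' h
  · exact h2 h

theorem fin_summand {A B : ModuleCat.{0} R} (h : IsSummand A B) (hB : Module.Finite R B) :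
    Module.Finite R A := by
  obtain ⟨i, p, h⟩ := h
  exact Module.Finite.of_surjective p (fun x => ⟨i x, LinearMap.congr_fun h x⟩)

theorem indec_local {X : ModuleCat.{0} R} (hX : Module.Finite R X) (h : Indec X)
    (a : Module.End R X) : IsNilpotent a ∨ IsUnit a := by
  obtain ⟨n, hn⟩ := Filter.eventually_atTop.1 a.eventually_isCompl_ker_pow_range_pow
  have hn := hn (n+1) (by omega)
  rcases h.2 _ _ hn with h1 | h1
  · right
    rw [Module.End.isUnit_iff]
    apply IsArtinian.bijective_of_injective_endomorphism
    rw [← LinearMap.ker_eq_bot, eq_bot_iff, ← h1]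
    intro x hx
    rw [LinearMap.mem_ker] at hx ⊢
    rw [pow_succ, Module.End.mul_apply, hx, map_zero]
  · left
    exact ⟨n+1, LinearMap.range_eq_bot.1 h1⟩

theorem summand_of_unit {X A : ModuleCat.{0} R} (i : X →ₗ[R] A) (p : A →ₗ[R] X)
    (h : IsUnit (show Module.End R X from p ∘ₗ i)) : IsSummand X A := by
  obtain ⟨u, hu⟩ := h
  refine ⟨i, (show X →ₗ[R] X from (↑u⁻¹ : Module.End R X)) ∘ₗ p, ?_⟩
  have : (↑u⁻¹ : Module.End R X) * (show Module.End R X from p ∘ₗ i) = 1 := by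
    rw [← hu]; exact u.inv_mul
  exact this

theorem indec_prod {X A B : ModuleCat.{0} R} (hX : Module.Finite R X) (h : Indec X)
    (hs : IsSummand X (ModuleCat.of R (A × B))) : IsSummand X A ∨ IsSummand X B := by
  obtain ⟨i, p, hip⟩ := hs
  let i' : X →ₗ[R] A × B := i
  let p' : A × B →ₗ[R] X := p
  have hip' : ∀ x, p' (i' x) = x := fun x => LinearMap.congr_fun hip x
  let a : Module.End R X := (p' ∘ₗ LinearMap.inl R A B) ∘ₗ (LinearMap.fst R A B ∘ₗ i')
  let b : Module.End R X := (p' ∘ₗ LinearMap.inr R A B) ∘ₗ (LinearMap.snd R A B ∘ₗ i')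
  have hab : b = 1 - a := by
    rw [eq_sub_iff_add_eq']
    ext x
    show p' ((i' x).1, 0) + p' (0, (i' x).2) = x
    rw [← map_add]
    simp [hip']
  rcases indec_local hX h a with h1 | h1
  · right
    have hb : IsUnit b := by
      rw [hab]
      exact h1.isUnit_one_sub
    exact summand_of_unit _ _ hb
  · left
    exact summand_of_unit _ _ h1

theorem indec_memAdd {X Y : ModuleCat.{0} R} (hX : Module.Finite R X) (h : Indec X)
    (hs : MemAdd Y X) : IsSummand X Y := by
  obtain ⟨n, hn⟩ := hs
  induction n with
  | zero =>
    obtain ⟨i, p, hip⟩ := hn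
    exfalso
    obtain ⟨x, y, hxy⟩ := h.1
    apply hxy
    have hip' : ∀ x, p (i x) = x := fun x => LinearMap.congr_fun hip x
    rw [← hip' x, ← hip' y]
    congr 1
    exact funext fun i => i.elim0
  | succ n ih =>
    have : IsSummand X (ModuleCat.of R (Y × ModuleCat.of R (Fin n → Y))) :=
      isSummand_trans hn (isSummand_of_equiv (Fin.consLinearEquiv R (fun _ => Y)).symm)
    rcases indec_prod hX h this with h1 | h1
    · exact h1
    · exact ih h1

theorem exists_indec : ∀ (n : ℕ) (M : ModuleCat.{0} R), Module.Finite R M → len M = n →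
    Nontrivial M → ∃ X C : ModuleCat.{0} R, Indec X ∧ Nonempty (M ≃ₗ[R] X × C) := by
  intro n
  induction n using Nat.strong_induction_on with
  | _ n ih =>
    intro M hM hn hnt
    by_cases h : Indec M
    · exact ⟨M, ModuleCat.of R PUnit, h, ⟨(LinearEquiv.prodUnique (R := R)).symm⟩⟩
    · have : ∃ p q : Submodule R M, IsCompl p q ∧ p ≠ ⊥ ∧ q ≠ ⊥ := by
        by_contra hc
        apply h
        refine ⟨hnt, fun p q hpq => ?_⟩
        by_contra h'
        rw [not_or] at h'
        exact hc ⟨p, q, hpq, h'⟩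
      obtain ⟨p, q, hpq, hp, hq⟩ := this
      let e : M ≃ₗ[R] p × q := (Submodule.prodEquivOfIsCompl p q hpq).symm
      have hl := len_prod (A := ModuleCat.of R p) (B := ModuleCat.of R q) e hM
      have hq' := len_pos (A := ModuleCat.of R q) (inferInstanceAs (Module.Finite R q))
        ((Submodule.nontrivial_iff_ne_bot).2 hq)
      obtain ⟨X, C, hX, ⟨e'⟩⟩ := ih (len (ModuleCat.of R p)) (by omega) (ModuleCat.of R p)
        (inferInstanceAs (Module.Finite R p)) rfl ((Submodule.nontrivial_iff_ne_bot).2 hp)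
      exact ⟨X, ModuleCat.of R (C × q), hX,
        ⟨e ≪≫ₗ (LinearEquiv.prodCongr e' (.refl R q)) ≪≫ₗ LinearEquiv.prodAssoc R X C q⟩⟩

theorem ks_induct (Q : ModuleCat.{0} R → Prop) (h0 : ∀ M : ModuleCat.{0} R, Subsingleton M → Q M)
    (h1 : ∀ M X C : ModuleCat.{0} R, Module.Finite R M → Indec X → (M ≃ₗ[R] X × C) → Q C → Q M) :
    ∀ (n : ℕ) (M : ModuleCat.{0} R), Module.Finite R M → len M = n → Q M := by
  intro n
  induction n using Nat.strong_induction_on with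
  | _ n ih =>
    intro M hM hn
    rcases subsingleton_or_nontrivial M with h | h
    · exact h0 M h
    · obtain ⟨X, C, hX, ⟨e⟩⟩ := exists_indec n M hM hn h
      have hl := len_prod e hM
      have hXf : Module.Finite R X := fin_summand (isSummand_trans (summand_fst X C)
        (isSummand_of_equiv e.symm)) hM
      have hCf : Module.Finite R C := fin_summand (isSummand_trans (summand_snd X C)
        (isSummand_of_equiv e.symm)) hM
      have := len_pos hXf hX.1
      exact h1 M X C hM hX e (ih (len C) (by omega) C hCf rfl)

theorem basic_summand_of_memAdd {X Y : ModuleCat.{0} R} (hX : Module.Finite R X)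
    (hb : IsBasic X) (h : MemAdd Y X) : IsSummand X Y := by
  refine ks_induct (fun X => IsBasic X → MemAdd Y X → IsSummand X Y)
    (fun M hM _ _ => summand_of_subsingleton hM) ?_ _ X hX rfl hb h
  intro M X C hM hX e ih hb hadd
  have s1 : IsSummand X M := isSummand_trans (summand_fst X C) (isSummand_of_equiv e.symm)
  have s2 : IsSummand C M := isSummand_trans (summand_snd X C) (isSummand_of_equiv e.symm)
  have hXf := fin_summand s1 hM
  obtain ⟨Y', ⟨e'⟩⟩ := summand_compl (ih (basic_summand hb s2) (memAdd_summand hadd s2))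
  have h1 : IsSummand X Y := indec_memAdd hXf hX (memAdd_summand hadd s1)
  rcases indec_prod hXf hX (isSummand_trans h1
    (isSummand_of_equiv (B := ModuleCat.of R (C × Y')) e')) with h2 | h2
  · exfalso
    have := hb X (isSummand_trans (summand_prod (summand_refl X) h2) (isSummand_of_equiv e.symm))
    exact not_subsingleton_iff_nontrivial.2 hX.1 this
  · have h3 : IsSummand (ModuleCat.of R (X × C)) (ModuleCat.of R (Y' × C)) :=
      summand_prod h2 (summand_refl C)
    exact isSummand_trans (isSummand_of_equiv (B := ModuleCat.of R (X × C)) e)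
      (isSummand_trans h3 (isSummand_of_equiv
        ((LinearEquiv.prodComm R Y' C) ≪≫ₗ e'.symm)))

theorem iso_of_summand {X Y : ModuleCat.{0} R} (hX : Module.Finite R X)
    (h : IsSummand X Y) (h' : IsSummand Y X) : Nonempty (X ≃ₗ[R] Y) := by
  obtain ⟨i, p, hip⟩ := h
  obtain ⟨j, q, hjq⟩ := h'
  have hi : Function.Injective i := fun a b hab => by
    rw [← show p (i a) = a from LinearMap.congr_fun hip a, hab]
    exact LinearMap.congr_fun hip b
  have hj : Function.Injective j := fun a b hab => by
    rw [← show q (j a) = a from LinearMap.congr_fun hjq a, hab]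
    exact LinearMap.congr_fun hjq b
  have hs : Function.Surjective (j ∘ₗ i) :=
    IsArtinian.surjective_of_injective_endomorphism _ (by
      rw [LinearMap.coe_comp]; exact hj.comp hi)
  refine ⟨LinearEquiv.ofBijective i ⟨hi, fun y => ?_⟩⟩
  obtain ⟨x, hx⟩ := hs (j y)
  exact ⟨x, hj hx⟩

theorem iso_of_add {X Y : ModuleCat.{0} R} (hX : Module.Finite R X) (hY : Module.Finite R Y)
    (hbX : IsBasic X) (hbY : IsBasic Y) (h : Add X Y) (h' : Add Y X) : Nonempty (X ≃ₗ[R] Y) :=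
  iso_of_summand hX (basic_summand_of_memAdd hX hbX (add_iff.1 h'))
    (basic_summand_of_memAdd hY hbY (add_iff.1 h))

theorem projInj_summand {A B : ModuleCat.{0} R} (h : IsSummand A B) (hB : ProjInj B) :
    ProjInj A :=
  ⟨proj_iff.1 ((retr_iff.2 h).projective (proj_iff.2 hB.1)),
    inj_iff.1 ((retr_iff.2 h).injective (inj_iff.2 hB.2))⟩

theorem add_of_projInj {P E : ModuleCat.{0} R} (hP : IsMaxProjInjSummand P)
    (hE : Module.Finite R E) (hE' : ProjInj E) : Add P E := by
  refine ks_induct (fun E => ProjInj E → Add P E) ?_ ?_ _ E hE rfl hE'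
  · intro M hM _
    exact Add.zero P (ModuleCat.isZero_of_subsingleton M)
  · intro M X C hM hX e ih hp
    have s1 : IsSummand X M := isSummand_trans (summand_fst X C) (isSummand_of_equiv e.symm)
    have s2 : IsSummand C M := isSummand_trans (summand_snd X C) (isSummand_of_equiv e.symm)
    have hXf := fin_summand s1 hM
    have hXp := projInj_summand s1 hp
    refine Add.sum ?_ (ih (projInj_summand s2 hp)) (isSum_of_equiv e)
    rw [add_iff]
    refine hP.2.2 X ?_ hXp
    apply indec_memAdd hXf hX
    obtain ⟨n, f, hf⟩ := Module.Finite.exists_fin' R X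
    haveI := hXp.1
    obtain ⟨s, hs⟩ := Module.projective_lifting_property f LinearMap.id hf
    exact ⟨n, s, f, hs⟩

end ks
end AbsTilt
end

section
open CategoryTheory CategoryTheory.Limits Opposite PS

set_option linter.all false

namespace AbsTilt

section domdim
variable {R : Type} [Ring R]

/-- Generalised `DomdimGE` for a module. -/
def Dom (k : ℕ) (M : ModuleCat.{0} R) : Prop :=
  ∃ (Y : ℕ → ModuleCat.{0} R) (g : M →ₗ[R] Y 0) (f : ∀ i, Y i →ₗ[R] Y (i+1)),
    Function.Injective g ∧ Function.Exact g (f 0) ∧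
    (∀ i, Function.Exact (f i) (f (i+1))) ∧
    (∀ i, Module.Injective R (Y i)) ∧ (∀ i, i < k → Module.Projective R (Y i))

/-- Iterated cosyzygies. -/
noncomputable def cosyz (M : ModuleCat.{0} R) : ℕ → ModuleCat.{0} R
  | 0 => M
  | i+1 => ModuleCat.of R
      ((Injective.under (cosyz M i) : ModuleCat.{0} R) ⧸
        LinearMap.range (Injective.ι (cosyz M i)).hom)

theorem dom_zero (M : ModuleCat.{0} R) : Dom 0 M := by
  have hι : ∀ N : ModuleCat.{0} R, Function.Injective (Injective.ι N).hom := fun N =>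
    (ModuleCat.mono_iff_injective _).1 inferInstance
  have hex : ∀ i, Function.Exact (Injective.ι (cosyz M i)).hom
      (LinearMap.range (Injective.ι (cosyz M i)).hom).mkQ := fun i =>
    LinearMap.exact_map_mkQ_range _
  refine ⟨fun i => Injective.under (cosyz M i), (Injective.ι M).hom,
    fun i => (Injective.ι (cosyz M (i+1))).hom ∘ₗ
      (LinearMap.range (Injective.ι (cosyz M i)).hom).mkQ, hι M, ?_, ?_, ?_, ?_⟩
  · exact exact_comp_left (C := cosyz M 1) (hex 0) (hι (cosyz M 1))
  · intro i
    exact exact_comp_left (C := cosyz M (i+2))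
      (exact_comp_right (B := cosyz M (i+1)) (C := Injective.under (cosyz M (i+1)))
        (D := cosyz M (i+2)) (hex (i+1)) (Submodule.mkQ_surjective _)) (hι (cosyz M (i+2)))
  · intro i
    exact inj_iff.1 inferInstance
  · intro i hi
    omega

theorem dom_of_rres : ∀ (k : ℕ) (M : ModuleCat.{0} R),
    RRes (fun A => ProjInj A) (fun _ => True) k M → Dom k M := by
  intro k
  induction k with
  | zero => intro M _; exact dom_zero M
  | succ k ih =>
    rintro M ⟨P, L, i, p, h1, h2, h3⟩
    obtain ⟨Y, g, f, hg, h0, hf, hi, hp⟩ := ih L h3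
    obtain ⟨a1, a2, a3⟩ := (ses_iff _ _).1 h1
    refine ⟨consY P Y, i.hom, consf P Y (g ∘ₗ p.hom) f, a1, exact_comp_left a3 hg, ?_, ?_, ?_⟩
    · intro n
      cases n with
      | zero => exact exact_comp_right h0 a2
      | succ n => exact hf n
    · intro n
      cases n with
      | zero => exact h2.2
      | succ n => exact hi n
    · intro n hn
      cases n with
      | zero => exact h2.1
      | succ n => exact hp n (by omega)

theorem rres_of_dom (k : ℕ) (M : ModuleCat.{0} R) (h : Dom k M) :
    RRes (fun A => ProjInj A) (fun _ => True) k M := by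
  obtain ⟨Y, g, f, hg, h0, hf, hi, hp⟩ := h
  cases k with
  | zero => exact trivial
  | succ k =>
    refine cogen_of_seq k (consY M Y) (consf M Y g f) hg ?_ ?_
    · intro i _
      cases i with
      | zero => exact h0
      | succ i => exact hf i
    · intro i h1 h2
      obtain ⟨j, rfl⟩ : ∃ j, i = j + 1 := ⟨i-1, by omega⟩
      exact ⟨hp j (by omega), hi j⟩

variable [IsArtinianRing R] [IsNoetherianRing R]

theorem rres_strip {k : ℕ} {L A F : ModuleCat.{0} R} (hF : Module.Injective R F)
    (e : L ≃ₗ[R] A × F) (h : RRes (fun A => ProjInj A) (fun _ => True) k L) :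
    RRes (fun A => ProjInj A) (fun _ => True) k A := by
  cases k with
  | zero => exact trivial
  | succ k =>
    obtain ⟨Y, L', i, p, h1, h2, h3⟩ := h
    obtain ⟨a1, a2, a3⟩ := (ses_iff _ _).1 h1
    obtain ⟨r, hr⟩ := hF.out i.hom a1 (LinearMap.snd R A F ∘ₗ e.toLinearMap)
    have hr' : ∀ x, r (i.hom x) = (e x).2 := hr
    have hs : ∀ z : F, r (i.hom (e.symm (0, z))) = z := fun z => by rw [hr']; simp
    let G : ModuleCat.{0} R := ModuleCat.of R (LinearMap.ker r)
    let s : F →ₗ[R] Y := i.hom ∘ₗ e.symm.toLinearMap ∘ₗ LinearMap.inr R A F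
    have hs2 : ∀ z : F, r (s z) = z := hs
    have hps : ∀ z : F, p.hom (s z) = 0 := fun z => (a3 _).2 ⟨_, rfl⟩
    have hG : IsSummand G Y := by
      refine ⟨(LinearMap.ker r).subtype,
        LinearMap.codRestrict (LinearMap.ker r) (LinearMap.id - s ∘ₗ r) ?_, ?_⟩
      · intro x
        simp [hs2]
      · ext x
        have : r x.1 = 0 := x.2
        show x.1 - s (r x.1) = x.1
        rw [this]; simp
    let α : A →ₗ[R] G := LinearMap.codRestrict (LinearMap.ker r)
      (i.hom ∘ₗ e.symm.toLinearMap ∘ₗ LinearMap.inl R A F) (by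
        intro x
        show r (i.hom (e.symm (x, 0))) = 0
        rw [hr']; simp)
    have hα : ∀ x, (α x).1 = i.hom (e.symm (x, 0)) := fun x => rfl
    refine ⟨G, L', ModuleCat.ofHom α, ModuleCat.ofHom (p.hom ∘ₗ (LinearMap.ker r).subtype),
      (ses_iff _ _).2 ⟨?_, ?_, ?_⟩, projInj_summand hG h2, h3⟩
    · intro x y hxy
      have : i.hom (e.symm (x, 0)) = i.hom (e.symm (y, 0)) := congrArg Subtype.val hxy
      have := e.symm.injective (a1 this)
      exact congrArg Prod.fst this
    · intro l
      obtain ⟨y, rfl⟩ := a2 l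
      refine ⟨⟨y - s (r y), ?_⟩, ?_⟩
      · rw [LinearMap.mem_ker, map_sub, hs2, sub_self]
      · show p.hom (y - s (r y)) = p.hom y
        rw [map_sub, hps, sub_zero]
    · intro x
      constructor
      · intro hx
        obtain ⟨l, hl⟩ := (a3 x.1).1 hx
        have hx2 : r x.1 = 0 := x.2
        rw [← hl, hr'] at hx2
        refine ⟨(e l).1, Subtype.ext ?_⟩
        show i.hom (e.symm ((e l).1, 0)) = x.1
        rw [← hl, ← hx2]
        simp
      · rintro ⟨a, rfl⟩
        exact (a3 _).2 ⟨_, rfl⟩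

/-- The key step: replacing an arbitrary projective-injective embedding by a finitely
generated one. -/
theorem exists_small (K : Type) [Field K] [Algebra K R] [FiniteDimensional K R]
    {M Y : ModuleCat.{0} R} (hM : Module.Finite R M) (hY : ProjInj Y)
    (i : M →ₗ[R] Y) (hi : Function.Injective i) :
    ∃ (E : ModuleCat.{0} R) (j : M →ₗ[R] E) (u : E →ₗ[R] Y) (t : Y →ₗ[R] E),
      Module.Finite R E ∧ ProjInj E ∧ (∀ x, t (u x) = x) ∧ ∀ m, u (j m) = i m := by
  obtain ⟨n, j, hj⟩ := cogen_dreg K M hM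
  let J : ModuleCat.{0} R := ModuleCat.of R (Fin n → Dreg K R)
  haveI := dreg_injective K R
  haveI := dreg_finite K (R := R)
  have hJ : Module.Injective R J := inferInstanceAs (Module.Injective R (Fin n → Dreg K R))
  haveI hJf : Module.Finite R J := inferInstanceAs (Module.Finite R (Fin n → Dreg K R))
  let j' : M →ₗ[R] J := j
  obtain ⟨b, hb⟩ := hJ.out i hi j'
  obtain ⟨a, ha⟩ := hY.2.out j' hj i
  let c : Module.End R J := b ∘ₗ a
  have hc : ∀ m, c (j' m) = j' m := fun m => by
    show b (a (j' m)) = j' m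
    rw [ha, hb]
  have hcn : ∀ (n : ℕ) m, (c ^ n) (j' m) = j' m := by
    intro n
    induction n with
    | zero => intro m; rfl
    | succ n ih => intro m; rw [pow_succ, Module.End.mul_apply, hc, ih]
  obtain ⟨N, hN⟩ := Filter.eventually_atTop.1 c.eventually_isCompl_ker_pow_range_pow
  have hN := hN (N+1) (by omega)
  let E : ModuleCat.{0} R := ModuleCat.of R (LinearMap.range (c ^ (N+1)))
  let u : E →ₗ[R] Y := a ∘ₗ (LinearMap.range (c ^ (N+1))).subtype
  have hu : Function.Injective u := by
    rw [← LinearMap.ker_eq_bot, LinearMap.ker_eq_bot']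
    intro x hx
    have h1 : a x.1 = 0 := hx
    have h2 : (c ^ (N+1)) x.1 = 0 := by
      have h3 : ∀ z : J, a z = 0 → (c ^ (N+1)) z = 0 := by
        intro z hz
        rw [pow_succ, Module.End.mul_apply]
        show (c ^ N) (b (a z)) = 0
        rw [hz, map_zero, map_zero]
      exact h3 _ h1
    exact Subtype.ext ((Submodule.disjoint_def.1 hN.disjoint) x.1 h2 x.2)
  have hEs : IsSummand E J :=
    ⟨(LinearMap.range (c ^ (N+1))).subtype,
      Submodule.projectionOnto _ _ hN.symm, 
      LinearMap.ext fun x => Submodule.projectionOnto_apply_left hN.symm x⟩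
  have hEi : Module.Injective R E :=
    inj_iff.1 ((retr_iff.2 hEs).injective (inj_iff.2 hJ))
  obtain ⟨t, ht⟩ := hEi.out u hu LinearMap.id
  have hEY : IsSummand E Y := ⟨u, t, LinearMap.ext ht⟩
  refine ⟨E, LinearMap.codRestrict _ j' (fun m => ⟨j' m, hcn _ m⟩), u, t,
    fin_summand hEs hJf, projInj_summand hEY hY, ht, fun m => ha m⟩

theorem rres_small (K : Type) [Field K] [Algebra K R] [FiniteDimensional K R]
    {P : ModuleCat.{0} R} (hP : IsMaxProjInjSummand P) :
    ∀ (k : ℕ) (M : ModuleCat.{0} R), Module.Finite R M →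
      RRes (fun A => ProjInj A) (fun _ => True) k M → RRes (Add P) (fun _ => True) k M := by
  intro k
  induction k with
  | zero => intro M _ _; exact trivial
  | succ k ih =>
    rintro M hM ⟨Y, L, i, p, h1, h2, h3⟩
    obtain ⟨a1, a2, a3⟩ := (ses_iff _ _).1 h1
    obtain ⟨E, j, u, t, hE, hE', htu, huj⟩ := exists_small K hM h2 i.hom a1
    have hj : Function.Injective j := fun x y hxy => a1 (by rw [← huj, ← huj, hxy])
    have hexj := LinearMap.exact_map_mkQ_range j
    let A : ModuleCat.{0} R := ModuleCat.of R (E ⧸ LinearMap.range j)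
    let F : ModuleCat.{0} R := ModuleCat.of R (LinearMap.ker t)
    have hFs : IsSummand F Y := by
      refine ⟨(LinearMap.ker t).subtype,
        LinearMap.codRestrict (LinearMap.ker t) (LinearMap.id - u ∘ₗ t) ?_, ?_⟩
      · intro x
        simp [htu]
      · ext x
        have : t x.1 = 0 := x.2
        show x.1 - u (t x.1) = x.1
        rw [this]; simp
    have hpi : ∀ m, p.hom (i.hom m) = 0 := fun m => (a3 _).2 ⟨m, rfl⟩
    let α : A →ₗ[R] L := (LinearMap.range j).liftQ (p.hom ∘ₗ u) (by
      rintro _ ⟨m, rfl⟩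
      show p.hom (u (j m)) = 0
      rw [huj, hpi])
    let β : A × F →ₗ[R] L := α.coprod (p.hom ∘ₗ (LinearMap.ker t).subtype)
    have hβ : Function.Bijective β := by
      constructor
      · rw [← LinearMap.ker_eq_bot, LinearMap.ker_eq_bot']
        rintro ⟨x, f⟩ hx
        obtain ⟨x, rfl⟩ := Submodule.mkQ_surjective _ x
        have hx : p.hom (u x) + p.hom f.1 = 0 := hx
        rw [← map_add] at hx
        obtain ⟨m, hm⟩ := (a3 _).1 hx
        have hf : t f.1 = 0 := f.2
        have h4 := congrArg t hm
        rw [map_add, htu, hf, add_zero, ← huj, htu] at h4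
        have h5 : f.1 = 0 := by
          rw [← h4, huj] at hm
          exact (left_eq_add.1 hm)
        refine Prod.ext ?_ (Subtype.ext h5)
        show (LinearMap.range j).mkQ x = 0
        rw [Submodule.mkQ_apply, Submodule.Quotient.mk_eq_zero]
        exact ⟨m, h4⟩
      · intro l
        obtain ⟨y, rfl⟩ := a2 l
        refine ⟨((LinearMap.range j).mkQ (t y), ⟨y - u (t y), ?_⟩), ?_⟩
        · rw [LinearMap.mem_ker, map_sub, htu, sub_self]
        · show p.hom (u (t y)) + p.hom (y - u (t y)) = p.hom y
          rw [← map_add]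
          congr 1
          abel
    refine ⟨E, A, ModuleCat.ofHom j, ModuleCat.ofHom (LinearMap.range j).mkQ,
      (ses_iff _ _).2 ⟨hj, Submodule.mkQ_surjective _, hexj⟩, add_of_projInj hP hE hE', ?_⟩
    exact ih A (inferInstanceAs (Module.Finite R (E ⧸ LinearMap.range j)))
      (rres_strip (projInj_summand hFs h2).2 (LinearEquiv.ofBijective β hβ).symm h3)

theorem domdim_iff (K : Type) [Field K] [Algebra K R] [FiniteDimensional K R]
    {P : ModuleCat.{0} R} (hP : IsMaxProjInjSummand P) (k : ℕ) :
    Cogen k P (reg R) ↔ DomdimGE R k := by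
  constructor
  · intro h
    refine dom_of_rres k (reg R) (RRes.mono ?_ (fun _ h => h) k _ h)
    intro A hA
    obtain ⟨n, hn⟩ := add_iff.1 hA
    refine projInj_summand hn ⟨?_, ?_⟩
    · haveI := hP.2.1.1
      exact Module.Projective.of_equiv (DFinsupp.linearEquivFunOnFintype (R := R)
        (M := fun _ : Fin n => P))
    · haveI := hP.2.1.2
      exact inferInstanceAs (Module.Injective R (Fin n → P))
  · intro h
    exact rres_small K hP k (reg R) (inferInstanceAs (Module.Finite R R)) (rres_of_dom k _ h)

end domdim
end AbsTilt
end

open PS in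
/-- Proposition `gen-cogen-characterisation`.
(a) `gen_{k-1}(Π)` contains a `k`-tilting module iff `domdim Γ ≥ k`; a basic such module is
isomorphic to the `Π`-special `k`-tilting module `T_k`.
(b) Dually for `cogen^{k-1}(Π)` and the `Π`-special `k`-cotilting module `C^k`. -/
theorem statement1 (K : Type) [Field K] (Γ : Type) [Ring Γ] [Algebra K Γ]
    [FiniteDimensional K Γ] (hbasic : IsBasic (reg Γ)) (k : ℕ)
    (Pii : ModuleCat.{0} Γ) (hPii : IsMaxProjInjSummand Pii) :
    -- (a)
    ((∃ T : ModuleCat.{0} Γ, MemGenShift k Pii T ∧ IsTilting k T) ↔ DomdimGE Γ k) ∧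
    (∀ T Tk : ModuleCat.{0} Γ, MemGenShift k Pii T → IsTilting k T → IsBasic T →
      IsBasic Tk → IsSpecialTilting Pii k Tk → Nonempty (T ≃ₗ[Γ] Tk)) ∧
    -- (b)
    ((∃ C : ModuleCat.{0} Γ, MemCogenShift k Pii C ∧ IsCotilting K k C) ↔ DomdimGE Γ k) ∧
    (∀ C Ck : ModuleCat.{0} Γ, MemCogenShift k Pii C → IsCotilting K k C → IsBasic C →
      IsBasic Ck → IsSpecialCotilting K Pii k Ck → Nonempty (C ≃ₗ[Γ] Ck)) := by
  haveI : IsArtinianRing Γ := isArtinian_of_tower K inferInstance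
  haveI : IsNoetherianRing Γ := AbsTilt.noeth K Γ
  have hf : Module.Finite Γ Pii :=
    AbsTilt.fin_summand hPii.1 (inferInstanceAs (Module.Finite Γ Γ))
  have hp := AbsTilt.proj_iff.2 hPii.2.1.1
  have hi := AbsTilt.inj_iff.2 hPii.2.1.2
  let S := AbsTilt.modSetup K (R := Γ)
  refine ⟨?_, ?_, ?_, ?_⟩
  · rw [← AbsTilt.domdim_iff K hPii k]
    refine Iff.trans (exists_congr fun T => and_congr (AbsTilt.memGenShift_iff k Pii T)
      (AbsTilt.isTilting_iff K k T)) (S.tilt_iff hf hp hi)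
  · intro T Tk h1 h2 h3 h4 h5
    have := S.unique (k := k) (Q := Pii) (T := T) (T' := Tk) hf hp hi
      ((AbsTilt.isTilting_iff K k T).1 h2) ((AbsTilt.memGenShift_iff k Pii T).1 h1)
      ((AbsTilt.isTilting_iff K k Tk).1 h5.1) (AbsTilt.special_tilting Pii k Tk h5)
    exact AbsTilt.iso_of_add h2.1 h5.1.1 h3 h4 this.1 this.2
  · rw [← AbsTilt.domdim_iff K hPii k]
    refine Iff.trans (exists_congr fun T => and_congr (AbsTilt.memCogenShift_iff k Pii T)
      (AbsTilt.isCotilting_iff K k T)) (S.cotilt_iff hf hp hi)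
  · intro T Tk h1 h2 h3 h4 h5
    have := S.unique' (k := k) (Q := Pii) (C := T) (C' := Tk) hf hp hi
      ((AbsTilt.isCotilting_iff K k T).1 h2) ((AbsTilt.memCogenShift_iff k Pii T).1 h1)
      ((AbsTilt.isCotilting_iff K k Tk).1 h5.1) (AbsTilt.special_cotilting K Pii k Tk h5)
    exact AbsTilt.iso_of_add h2.1 h5.1.1 h3 h4 this.1 this.2
end

section
/- Let k ≥ 0 and k' > 0, and let Γ be a basic finite-dimensional algebra over a field with domdim Γ ≥ k + k'. If the shifted modules satisfy T_k ≅ T_{k+k'}, then Γ is selfinjective. Dually, if the coshifted modules satisfy C^k ≅ C^{k+k'}, then Γ is selfinjective. -/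
/-!
Formalization of definitions from "Special tilting modules for algebras with positive
dominant dimension" (Pressland–Sauter), together with one of its statements.
-/

open CategoryTheory

namespace PSaux
open PS

variable {R : Type} [Ring R]

/-- Short exact sequences of modules from linear maps. -/
lemma shortExact {A B C : Type} [AddCommGroup A] [AddCommGroup B] [AddCommGroup C]
    [Module R A] [Module R B] [Module R C] (f : A →ₗ[R] B) (g : B →ₗ[R] C)
    (hf : Function.Injective f) (hfg : Function.Exact f g) (hg : Function.Surjective g) :
    (ModuleCat.shortComplexOfCompEqZero f g hfg.linearMap_comp_eq_zero).ShortExact :=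
  ModuleCat.shortComplex_shortExact _ hfg hf hg

lemma rangeSES {A B C : Type} [AddCommGroup A] [AddCommGroup B] [AddCommGroup C]
    [Module R A] [Module R B] [Module R C] (f : A →ₗ[R] B) (g : B →ₗ[R] C)
    (hfg : Function.Exact f g) :
    Function.Exact (LinearMap.range f).subtype g.rangeRestrict := by
  intro y
  constructor
  · intro h
    have h' : g y = 0 := congrArg Subtype.val h
    obtain ⟨x, hx⟩ := (hfg y).1 h'
    exact ⟨⟨y, x, hx⟩, rfl⟩
  · rintro ⟨⟨_, x, rfl⟩, rfl⟩
    exact Subtype.ext ((hfg _).2 ⟨x, rfl⟩)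

/-- Retract from linear maps. -/
def retractOf {M N : Type} [AddCommGroup M] [AddCommGroup N] [Module R M] [Module R N]
    (i : N →ₗ[R] M) (p : M →ₗ[R] N) (h : p ∘ₗ i = LinearMap.id) :
    Retract (ModuleCat.of R N) (ModuleCat.of R M) where
  i := ModuleCat.ofHom i
  r := ModuleCat.ofHom p
  retract := by
    rw [← ModuleCat.ofHom_comp, h]
    rfl

lemma injective_of_retract {M N : Type} [AddCommGroup M] [AddCommGroup N] [Module R M]
    [Module R N] (i : N →ₗ[R] M) (p : M →ₗ[R] N) (h : p ∘ₗ i = LinearMap.id)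
    (hM : Module.Injective R M) : Module.Injective R N where
  out X Y _ _ _ _ f hf g := by
    obtain ⟨l, hl⟩ := hM.out f hf (i ∘ₗ g)
    refine ⟨p ∘ₗ l, fun x => ?_⟩
    have := LinearMap.congr_fun h (g x)
    simp only [LinearMap.comp_apply, hl]
    exact this

abbrev PD (M : Type) [AddCommGroup M] [Module R M] (n : ℕ) : Prop :=
  HasProjectiveDimensionLT (ModuleCat.of R M) n

abbrev ID (M : Type) [AddCommGroup M] [Module R M] (n : ℕ) : Prop :=
  HasInjectiveDimensionLT (ModuleCat.of R M) n

lemma pd_one (M : Type) [AddCommGroup M] [Module R M] :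
    PD (R := R) M 1 ↔ Module.Projective R M := by
  rw [IsProjective.iff_projective]
  exact projective_iff_hasProjectiveDimensionLT_one.symm

lemma id_one (M : Type) [AddCommGroup M] [Module R M] :
    ID (R := R) M 1 ↔ Module.Injective R M := by
  rw [Module.injective_iff_injective_object]
  exact injective_iff_hasInjectiveDimensionLT_one.symm

lemma PD.mono {M : Type} [AddCommGroup M] [Module R M] {m n : ℕ} (h : PD (R := R) M m)
    (hmn : m ≤ n) : PD (R := R) M n :=
  hasProjectiveDimensionLT_of_ge _ m n hmn

lemma ID.mono {M : Type} [AddCommGroup M] [Module R M] {m n : ℕ} (h : ID (R := R) M m)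
    (hmn : m ≤ n) : ID (R := R) M n :=
  hasInjectiveDimensionLT_of_ge _ m n hmn

lemma PD.retract {M N : Type} [AddCommGroup M] [AddCommGroup N] [Module R M] [Module R N]
    {n : ℕ} (hM : PD (R := R) M n) (i : N →ₗ[R] M) (p : M →ₗ[R] N)
    (h : p ∘ₗ i = LinearMap.id) : PD (R := R) N n :=
  (retractOf i p h).hasProjectiveDimensionLT n

lemma ID.retract {M N : Type} [AddCommGroup M] [AddCommGroup N] [Module R M] [Module R N]
    {n : ℕ} (hM : ID (R := R) M n) (i : N →ₗ[R] M) (p : M →ₗ[R] N)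
    (h : p ∘ₗ i = LinearMap.id) : ID (R := R) N n :=
  (retractOf i p h).hasInjectiveDimensionLT n

lemma PD.equiv {M N : Type} [AddCommGroup M] [AddCommGroup N] [Module R M] [Module R N]
    {n : ℕ} (hM : PD (R := R) M n) (e : N ≃ₗ[R] M) : PD (R := R) N n :=
  hM.retract e.toLinearMap e.symm.toLinearMap (by ext; simp)

lemma ID.equiv {M N : Type} [AddCommGroup M] [AddCommGroup N] [Module R M] [Module R N]
    {n : ℕ} (hM : ID (R := R) M n) (e : N ≃ₗ[R] M) : ID (R := R) N n :=
  hM.retract e.toLinearMap e.symm.toLinearMap (by ext; simp)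

lemma consExact (M : Type) [AddCommGroup M] [Module R M] (m : ℕ) :
    Function.Injective (LinearMap.single R (fun _ : Fin (m+1) => M) 0) ∧
    Function.Exact (LinearMap.single R (fun _ : Fin (m+1) => M) 0)
      (LinearMap.funLeft R M (Fin.succ : Fin m → Fin (m+1))) ∧
    Function.Surjective (LinearMap.funLeft R M (Fin.succ : Fin m → Fin (m+1))) := by
  refine ⟨fun x y h => by simpa using congrFun h 0, ?_, ?_⟩
  · intro y
    constructor
    · intro h
      refine ⟨y 0, ?_⟩
      ext j
      refine Fin.cases ?_ (fun j => ?_) j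
      · simp
      · have := congrFun h j
        simpa [LinearMap.funLeft_apply] using this.symm
    · rintro ⟨x, rfl⟩
      ext j
      simp [LinearMap.funLeft_apply]
  · exact LinearMap.funLeft_surjective_of_injective R M _ (Fin.succ_injective m)

lemma PD.pi {M : Type} [AddCommGroup M] [Module R M] {n : ℕ} (h : PD (R := R) M n) (m : ℕ) :
    PD (R := R) (Fin m → M) n := by
  induction m with
  | zero =>
    have : PD (R := R) (Fin 0 → M) 0 :=
      (ModuleCat.isZero_of_subsingleton _).hasProjectiveDimensionLT_zero
    exact this.mono (Nat.zero_le _)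
  | succ m ih =>
    obtain ⟨h1, h2, h3⟩ := consExact (R := R) M m
    exact (shortExact _ _ h1 h2 h3).hasProjectiveDimensionLT_X₂ n h ih

lemma ID.pi {M : Type} [AddCommGroup M] [Module R M] {n : ℕ} (h : ID (R := R) M n) (m : ℕ) :
    ID (R := R) (Fin m → M) n := by
  induction m with
  | zero =>
    have : ID (R := R) (Fin 0 → M) 0 :=
      (ModuleCat.isZero_of_subsingleton _).hasInjectiveDimensionLT_zero
    exact this.mono (Nat.zero_le _)
  | succ m ih =>
    obtain ⟨h1, h2, h3⟩ := consExact (R := R) M m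
    exact (shortExact _ _ h1 h2 h3).hasInjectiveDimensionLT_X₂ n h ih

lemma PD.memAdd {X M : ModuleCat.{0} R} {n : ℕ} (h : PD (R := R) X n) (hM : MemAdd X M) :
    PD (R := R) M n := by
  obtain ⟨m, i, p, hip⟩ := hM
  exact (h.pi m).retract i p hip

lemma ID.memAdd {X M : ModuleCat.{0} R} {n : ℕ} (h : ID (R := R) X n) (hM : MemAdd X M) :
    ID (R := R) M n := by
  obtain ⟨m, i, p, hip⟩ := hM
  exact (h.pi m).retract i p hip

section Seq

variable {n : ℕ} {Y : ℕ → ModuleCat.{0} R} {f : ∀ i, Y i →ₗ[R] Y (i+1)}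

noncomputable def firstEquiv (h : IsExactSeq (n+1) Y f) : Y 0 ≃ₗ[R] LinearMap.range (f 0) :=
  LinearEquiv.ofInjective (f 0) h.1

noncomputable def lastEquiv (h : IsExactSeq (n+1) Y f) : LinearMap.range (f n) ≃ₗ[R] Y (n+1) :=
  LinearEquiv.ofTop _ (LinearMap.range_eq_top.2 h.2.1)

lemma ses (h : IsExactSeq (n+1) Y f) (i : ℕ) (hi : i + 1 ≤ n) :
    (ModuleCat.shortComplexOfCompEqZero (LinearMap.range (f i)).subtype
      (f (i+1)).rangeRestrict
      (rangeSES _ _ (h.2.2 i (by omega))).linearMap_comp_eq_zero).ShortExact :=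
  shortExact _ _ (Submodule.injective_subtype _) (rangeSES _ _ (h.2.2 i (by omega)))
    (LinearMap.surjective_rangeRestrict _)

end Seq

lemma pd_of_PdimLE {k : ℕ} {M : ModuleCat.{0} R} (h : PdimLE k M) : PD (R := R) M (k+1) := by
  obtain ⟨Y, f, hex, hproj, rfl⟩ := h
  have key : ∀ i, i ≤ k → PD (R := R) (LinearMap.range (f i)) (i+1) := by
    intro i
    induction i with
    | zero =>
      intro _
      exact ((pd_one (R := R) (Y 0)).2 (hproj 0 (Nat.zero_le _))).equiv (firstEquiv hex).symm
    | succ i ih =>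
      intro hi
      exact (ses hex i hi).hasProjectiveDimensionLT_X₃ (i+1) (ih (by omega))
        (((pd_one (R := R) (Y (i+1))).2 (hproj (i+1) hi)).mono (by omega))
  exact (key k le_rfl).equiv (lastEquiv hex).symm

lemma id_of_IdimLE {k : ℕ} {M : ModuleCat.{0} R} (h : IdimLE k M) : ID (R := R) M (k+1) := by
  obtain ⟨Y, f, hex, hinj, rfl⟩ := h
  have key : ∀ j i, i + j = k → ID (R := R) (LinearMap.range (f i)) (j+1) := by
    intro j
    induction j with
    | zero =>
      rintro i rfl
      exact ((id_one (R := R) (Y (i+1))).2 (hinj (i+1) (by omega) (by omega))).equiv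
        (lastEquiv hex)
    | succ j ih =>
      intro i hi
      exact (ses hex i (by omega)).hasInjectiveDimensionLT_X₁ (j+1) (ih (i+1) (by omega))
        (((id_one (R := R) (Y (i+1))).2 (hinj (i+1) (by omega) (by omega))).mono (by omega))
  exact (key k 0 (by omega)).equiv (firstEquiv hex)

/-- The tilting half: a long coresolution by projectives of something with small projective
dimension splits at the beginning. -/
lemma split_first {n : ℕ} (hn : 1 ≤ n) {Y : ℕ → ModuleCat.{0} R}
    {f : ∀ i, Y i →ₗ[R] Y (i+1)} (hex : IsExactSeq (n+1) Y f)
    (hproj : ∀ i, 1 ≤ i → i ≤ n → Module.Projective R (Y i))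
    (hlast : PD (R := R) (Y (n+1)) n) : IsSummand (Y 0) (Y 1) := by
  have key : ∀ j i, 1 ≤ i → i + j = n → PD (R := R) (LinearMap.range (f i)) i := by
    intro j
    induction j with
    | zero =>
      rintro i _ rfl
      exact hlast.equiv (lastEquiv hex)
    | succ j ih =>
      intro i h1 hi
      exact (ses hex i (by omega)).hasProjectiveDimensionLT_X₁ i
        (((pd_one (R := R) (Y (i+1))).2 (hproj (i+1) (by omega) (by omega))).mono h1)
        (ih (i+1) (by omega) (by omega))
  have hP : Module.Projective R (LinearMap.range (f 1)) :=
    (pd_one _).1 (key (n-1) 1 le_rfl (by omega))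
  obtain ⟨s, hs⟩ := Module.projective_lifting_property (f 1).rangeRestrict LinearMap.id
    (LinearMap.surjective_rangeRestrict _)
  have hexact : Function.Exact (f 0) (f 1) := hex.2.2 0 (by omega)
  have hmem : ∀ y : Y 1, y - s ((f 1).rangeRestrict y) ∈ LinearMap.range (f 0) := by
    intro y
    apply (hexact _).1
    have := congrArg Subtype.val (LinearMap.congr_fun hs ((f 1).rangeRestrict y))
    have this : f 1 (s ((f 1).rangeRestrict y)) = f 1 y := this
    rw [map_sub, this, sub_self]
  refine ⟨f 0, (firstEquiv hex).symm.toLinearMap ∘ₗ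
    ((LinearMap.id - s ∘ₗ (f 1).rangeRestrict).codRestrict _ hmem), ?_⟩
  ext x
  simp only [LinearMap.comp_apply, LinearEquiv.coe_coe, LinearMap.id_apply]
  rw [LinearEquiv.symm_apply_eq]
  apply Subtype.ext
  have h0 : (f 1).rangeRestrict (f 0 x) = 0 := Subtype.ext (hexact.apply_apply_eq_zero x)
  change f 0 x - s ((f 1).rangeRestrict (f 0 x)) = f 0 x
  rw [h0, map_zero, sub_zero]

/-- The cotilting half. -/
lemma split_last {n : ℕ} {Y : ℕ → ModuleCat.{0} R}
    {f : ∀ i, Y i →ₗ[R] Y (i+1)} (hex : IsExactSeq (n+1+1) Y f)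
    (hinj : ∀ i, 1 ≤ i → i ≤ n+1 → Module.Injective R (Y i))
    (hfirst : ID (R := R) (Y 0) (n+1)) : IsSummand (Y (n+2)) (Y (n+1)) := by
  have key : ∀ i j, i + j = n → ID (R := R) (LinearMap.range (f i)) (j+1) := by
    intro i
    induction i with
    | zero =>
      intro j hj
      obtain rfl : j = n := by omega
      exact hfirst.equiv (firstEquiv hex).symm
    | succ i ih =>
      intro j hj
      exact (ses hex i (by omega)).hasInjectiveDimensionLT_X₃ (j+1)
        (((id_one (R := R) (Y (i+1))).2 (hinj (i+1) (by omega) (by omega))).mono (by omega))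
        (ih (j+1) (by omega))
  have hI : Module.Injective R (LinearMap.range (f n)) := (id_one _).1 (key n 0 rfl)
  obtain ⟨r, hr⟩ := hI.out (LinearMap.range (f n)).subtype (Submodule.injective_subtype _)
    LinearMap.id
  have hexact : Function.Exact (f n) (f (n+1)) := hex.2.2 n (by omega)
  have hsurj : Function.Surjective (f (n+1)) := hex.2.1
  -- section of `f (n+1)`
  let g : Y (n+1) →ₗ[R] Y (n+1) := LinearMap.id - (LinearMap.range (f n)).subtype ∘ₗ r
  have hg : LinearMap.ker (f (n+1)) ≤ LinearMap.ker g := by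
    intro y hy
    obtain ⟨x, rfl⟩ := (hexact y).1 hy
    have := hr ⟨f n x, x, rfl⟩
    change f n x - (r (f n x) : Y (n+1)) = 0
    rw [show r (f n x) = _ from this]
    simp
  let e := (f (n+1)).quotKerEquivOfSurjective hsurj
  refine ⟨(LinearMap.ker (f (n+1))).liftQ g hg ∘ₗ e.symm.toLinearMap, f (n+1), ?_⟩
  ext y
  obtain ⟨x, rfl⟩ := hsurj y
  have he : e.symm (f (n+1) x) = Submodule.Quotient.mk x := by
    rw [LinearEquiv.symm_apply_eq]; rfl
  simp only [LinearMap.comp_apply, LinearEquiv.coe_coe, LinearMap.id_apply]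
  rw [he]
  change f (n+1) (x - (r x : Y (n+1))) = f (n+1) x
  rw [map_sub, (hexact _).2 (r x).2, sub_zero]

section Trace

variable {P : Type} [AddCommGroup P] [Module R P] (ρ : R →+ Module.End R P)

/-- The ideal attached to `J`. -/
def F (J : Ideal R) : Ideal R :=
  Submodule.span R {y | ∃ (b : P →ₗ[R] R) (x : P), ∃ a ∈ J, y = b (ρ a x)}

lemma F_mono {J J' : Ideal R} (h : J ≤ J') : F ρ J ≤ F ρ J' :=
  Submodule.span_mono (by rintro _ ⟨b, x, a, ha, rfl⟩; exact ⟨b, x, a, h ha, rfl⟩)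

def Two (J : Ideal R) : Prop := ∀ a ∈ J, ∀ c, a * c ∈ J

lemma F_two (J : Ideal R) : Two (F ρ J) := by
  intro y hy c
  induction hy using Submodule.span_induction with
  | mem y hy =>
    obtain ⟨b, x, a, ha, rfl⟩ := hy
    exact Submodule.subset_span ⟨LinearMap.toSpanSingleton R R c ∘ₗ b, x, a, ha, by simp⟩
  | zero => simp
  | add x y _ _ hx hy => rw [add_mul]; exact add_mem hx hy
  | smul r x _ hx => rw [smul_eq_mul, mul_assoc]; exact Ideal.mul_mem_left _ _ hx

lemma F_inj (hmul : ∀ a c, ρ (a * c) = ρ c * ρ a) (hbij : Function.Bijective ρ)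
    {m : ℕ} (ι : P →ₗ[R] (Fin m → R)) (π : (Fin m → R) →ₗ[R] P) (hπ : π ∘ₗ ι = LinearMap.id)
    {J J' : Ideal R} (hJ' : Two J') (h : F ρ J ≤ F ρ J') : J ≤ J' := by
  intro a ha
  let N : Submodule R P := Submodule.span R {q | ∃ a' ∈ J', ∃ x, q = ρ a' x}
  have dual : ∀ p, p = ∑ j, ι p j • π (Pi.single j 1) := by
    intro p
    have h1 : ι p = ∑ j, ι p j • (Pi.single j (1 : R) : Fin m → R) := by
      ext i
      simp [Finset.sum_apply, Pi.single_apply]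
    have h2 : π (ι p) = p := LinearMap.congr_fun hπ p
    calc p = π (ι p) := h2.symm
      _ = π (∑ j, ι p j • (Pi.single j (1 : R) : Fin m → R)) := by rw [← h1]
      _ = _ := by simp
  have c1 : ∀ y ∈ F ρ J', ∀ p : P, y • p ∈ N := by
    intro y hy p
    induction hy using Submodule.span_induction with
    | mem y hy =>
      obtain ⟨b, x, a', ha', rfl⟩ := hy
      obtain ⟨c, hc⟩ := hbij.2 (LinearMap.toSpanSingleton R P p ∘ₗ b)
      refine Submodule.subset_span ⟨a' * c, hJ' _ ha' c, x, ?_⟩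
      rw [hmul, hc]
      rfl
    | zero => simp
    | add x y _ _ hx hy => rw [add_smul]; exact add_mem hx hy
    | smul r x _ hx => rw [smul_assoc]; exact N.smul_mem _ hx
  have c2 : ∀ x, ρ a x ∈ N := by
    intro x
    rw [dual (ρ a x)]
    refine sum_mem fun j _ => c1 _ (h ?_) _
    exact Submodule.subset_span ⟨LinearMap.proj j ∘ₗ ι, x, a, ha, rfl⟩
  have c3 : ∀ q ∈ N, ∀ b : P →ₗ[R] R, ∃ a' ∈ J', ∀ x, b x • q = ρ a' x := by
    intro q hq
    induction hq using Submodule.span_induction with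
    | mem q hq =>
      obtain ⟨a', ha', p, rfl⟩ := hq
      intro b
      obtain ⟨c, hc⟩ := hbij.2 (LinearMap.toSpanSingleton R P p ∘ₗ b)
      refine ⟨c * a', J'.mul_mem_left c ha', fun x => ?_⟩
      rw [hmul, hc]
      simp
    | zero => exact fun b => ⟨0, zero_mem _, by simp⟩
    | add q q' _ _ hq hq' =>
      intro b
      obtain ⟨a1, h1, h1'⟩ := hq b
      obtain ⟨a2, h2, h2'⟩ := hq' b
      exact ⟨a1 + a2, add_mem h1 h2, fun x => by simp [h1', h2']⟩
    | smul r q _ hq =>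
      intro b
      obtain ⟨a1, h1, h1'⟩ := hq (LinearMap.toSpanSingleton R R r ∘ₗ b)
      refine ⟨a1, h1, fun x => ?_⟩
      rw [← h1']
      simp [mul_smul]
  choose a' ha' ha'' using fun j : Fin m =>
    c3 _ (c2 (π (Pi.single j 1))) (LinearMap.proj j ∘ₗ ι)
  have : a = ∑ j, a' j := by
    apply hbij.1
    ext x
    conv_lhs => rw [dual x]
    rw [map_sum, map_sum, LinearMap.sum_apply]
    refine Finset.sum_congr rfl fun j _ => ?_
    rw [map_smul, ← ha'']
    rfl
  rw [this]
  exact sum_mem fun j _ => ha' j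

lemma F_top [IsArtinianRing R] (hmul : ∀ a c, ρ (a * c) = ρ c * ρ a)
    (hbij : Function.Bijective ρ)
    {m : ℕ} (ι : P →ₗ[R] (Fin m → R)) (π : (Fin m → R) →ₗ[R] P)
    (hπ : π ∘ₗ ι = LinearMap.id) : F ρ ⊤ = ⊤ := by
  let G : ℕ → Ideal R := fun n => (F ρ)^[n] ⊤
  have hG : ∀ n, G (n+1) = F ρ (G n) := fun n => Function.iterate_succ_apply' _ _ _
  have h2 : ∀ n, Two (G n) := by
    intro n
    cases n with
    | zero => intro a _ c; exact Submodule.mem_top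
    | succ n => rw [hG]; exact F_two ρ _
  have hle : ∀ n, G (n+1) ≤ G n := by
    intro n
    induction n with
    | zero => exact le_top
    | succ n ih => rw [hG, hG n]; rw [hG] at ih; exact F_mono ρ ih
  obtain ⟨n, hn⟩ := IsArtinian.monotone_stabilizes (R := R) (M := R)
    ⟨fun n => OrderDual.toDual (G n), monotone_nat_of_le_succ hle⟩
  have hst : G n ≤ G (n+1) := le_of_eq (hn (n+1) (by omega))
  have key : ∀ n, G n ≤ G (n+1) → G 0 ≤ G 1 := by
    intro n
    induction n with
    | zero => exact id
    | succ n ih =>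
      intro h
      rw [hG n, hG (n+1)] at h
      exact ih (F_inj ρ hmul hbij ι π hπ (h2 _) h)
  exact top_le_iff.1 (key n hst)

lemma injective_of_trace [IsArtinianRing R] [Module.Finite R P] [Module.Projective R P]
    (hI : Module.Injective R P) (hmul : ∀ a c, ρ (a * c) = ρ c * ρ a)
    (hbij : Function.Bijective ρ) : Module.Injective R R := by
  obtain ⟨m, π, hsurj⟩ := Module.Finite.exists_fin' R P
  obtain ⟨ι, hι⟩ := Module.projective_lifting_property π LinearMap.id hsurj
  have h1 : (1 : R) ∈ F ρ ⊤ := by rw [F_top ρ hmul hbij ι π hι]; trivial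
  obtain ⟨n, c, g, hs⟩ := Submodule.mem_span_set'.1 h1
  choose b x a ha hg using fun i => (g i).2
  refine injective_of_retract (M := Fin n → P)
    (LinearMap.pi fun i => LinearMap.toSpanSingleton R P (c i • ρ (a i) (x i)))
    (∑ i, b i ∘ₗ LinearMap.proj i) ?_ inferInstance
  ext
  simp [← hg]
  simpa using hs

end Trace

section Dual
variable (K : Type) [Field K] (R) [Algebra K R]

lemma dreg_smul (a : R) (φ : Dreg K R) (x : R) :
    (show R →ₗ[K] K from a • φ) x = (show R →ₗ[K] K from φ) (x * a) := rfl

/-- The right action of `R` on `D R`. -/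
def rho : R →+ Module.End R (Dreg K R) where
  toFun c :=
    { toFun := fun φ => (show R →ₗ[K] K from φ) ∘ₗ LinearMap.mulLeft K c
      map_add' := fun φ ψ => rfl
      map_smul' := fun a φ => by
        refine LinearMap.ext fun x => ?_
        change (show R →ₗ[K] K from φ) ((c * x) * a) = (show R →ₗ[K] K from φ) (c * (x * a))
        rw [mul_assoc] }
  map_zero' := by
    refine LinearMap.ext fun φ => LinearMap.ext fun x => ?_
    change (show R →ₗ[K] K from φ) (0 * x) = 0
    rw [zero_mul, map_zero]
  map_add' c d := by
    refine LinearMap.ext fun φ => LinearMap.ext fun x => ?_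
    change (show R →ₗ[K] K from φ) ((c + d) * x)
      = (show R →ₗ[K] K from φ) (c * x) + (show R →ₗ[K] K from φ) (d * x)
    rw [add_mul, map_add]

lemma rho_apply (c : R) (φ : R →ₗ[K] K) (x : R) :
    (show R →ₗ[K] K from rho R K c φ) x = φ (c * x) := rfl

lemma rho_mul (a c : R) : rho R K (a * c) = rho R K c * rho R K a := by
  refine LinearMap.ext fun φ => LinearMap.ext fun x => ?_
  change (show R →ₗ[K] K from φ) (a * c * x) = (show R →ₗ[K] K from φ) (a * (c * x))
  rw [mul_assoc]

lemma rho_bij [FiniteDimensional K R] : Function.Bijective (rho R K) := by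
  constructor
  · intro c d h
    rw [← sub_eq_zero, ← Module.forall_dual_apply_eq_zero_iff K]
    intro φ
    have : (show R →ₗ[K] K from rho R K c φ) 1 = (show R →ₗ[K] K from rho R K d φ) 1 := by
      rw [h]
    rw [rho_apply, rho_apply, mul_one, mul_one] at this
    rw [map_sub, this, sub_self]
  · intro g
    have hK : ∀ (t : K) (φ : R →ₗ[K] K), (show Dreg K R from t • φ)
        = (algebraMap K R t) • (show Dreg K R from φ) := by
      intro t φ
      refine LinearMap.ext fun x => ?_
      change t • φ x = φ (x * algebraMap K R t)
      rw [← Algebra.commutes, ← Algebra.smul_def, map_smul]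
    let ev : Module.Dual K (Module.Dual K R) :=
      { toFun := fun φ => (show R →ₗ[K] K from g φ) 1
        map_add' := fun φ ψ => by
          have : g (show Dreg K R from φ + ψ) = g φ + g ψ := map_add g _ _
          rw [this]; rfl
        map_smul' := fun t φ => by
          have : g (show Dreg K R from t • φ) = (algebraMap K R t) • g φ := by
            rw [hK]; exact map_smul g _ _
          rw [this]
          exact LinearMap.congr_fun (hK t (g φ)).symm 1 }
    obtain ⟨c, hc⟩ := (Module.evalEquiv K R).surjective ev
    refine ⟨c, LinearMap.ext fun φ => LinearMap.ext fun x => ?_⟩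
    have h1 := LinearMap.congr_fun hc (show R →ₗ[K] K from x • φ)
    have h2 : g (x • φ) = x • g φ := map_smul g _ _
    have h3 : ev (show R →ₗ[K] K from x • φ) = (show R →ₗ[K] K from x • g φ) 1 := by
      rw [← h2]; rfl
    rw [h3] at h1
    have h4 : (show R →ₗ[K] K from x • g φ) 1 = (show R →ₗ[K] K from g φ) x := by
      rw [dreg_smul, one_mul]
    rw [h4] at h1
    exact h1

end Dual

end PSaux

open PS in
/-- Proposition `domdim-infty`.
Let `k ≥ 0`, `k' > 0` and let `Γ` be a basic finite-dimensional algebra with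
`domdim Γ ≥ k + k'`.  If the shifted modules satisfy `T_k ≅ T_{k+k'}` then `Γ` is
selfinjective, and dually for the coshifted modules. -/
theorem statement2 (K : Type) [Field K] (Γ : Type) [Ring Γ] [Algebra K Γ]
    [FiniteDimensional K Γ] (hbasic : IsBasic (reg Γ)) (k k' : ℕ) (hk' : 0 < k')
    (hdom : DomdimGE Γ (k + k')) (Pii : ModuleCat.{0} Γ) (hPii : IsMaxProjInjSummand Pii) :
    (∀ T T' : ModuleCat.{0} Γ, IsBasic T → IsSpecialTilting Pii k T →
      IsBasic T' → IsSpecialTilting Pii (k + k') T' → Nonempty (T ≃ₗ[Γ] T') →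
      Module.Injective Γ Γ) ∧
    (∀ C C' : ModuleCat.{0} Γ, IsBasic C → IsSpecialCotilting K Pii k C →
      IsBasic C' → IsSpecialCotilting K Pii (k + k') C' → Nonempty (C ≃ₗ[Γ] C') →
      Module.Injective Γ Γ) := by
  obtain ⟨⟨ιP, πP, hιP⟩, ⟨hPp, hPi⟩, -⟩ := hPii
  have hPfin : Module.Finite Γ Pii :=
    haveI : Module.Finite Γ (reg Γ) := inferInstanceAs (Module.Finite Γ Γ)
    Module.Finite.of_surjective πP (fun x => ⟨ιP x, LinearMap.congr_fun hιP x⟩)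
  have addP : ∀ Q : ModuleCat.{0} Γ, MemAdd Pii Q →
      Module.Projective Γ Q ∧ Module.Injective Γ Q := fun Q hQ =>
    ⟨(PSaux.pd_one _).1 (((PSaux.pd_one _).2 hPp).memAdd hQ),
      (PSaux.id_one _).1 (((PSaux.id_one _).2 hPi).memAdd hQ)⟩
  refine ⟨?_, ?_⟩
  · rintro T T' - hT - hT' ⟨e⟩
    obtain ⟨-, Y, f, hex, h0, hadd, hP⟩ := hT'
    have hpd : PSaux.PD (R := Γ) T' (k + k') :=
      ((PSaux.pd_of_PdimLE hT.1.2.1).equiv e.symm).mono (by omega)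
    obtain ⟨i, p, hip⟩ := PSaux.split_first (by omega) hex
      (fun i h1 h2 => (addP _ (hP i h1 h2)).1) (hpd.memAdd (hadd _ (by omega) le_rfl))
    have : Module.Injective Γ (Y 0) :=
      PSaux.injective_of_retract i p hip (addP _ (hP 1 le_rfl (by omega))).2
    rw [h0] at this
    exact this
  · rintro C C' - hC - hC' ⟨e⟩
    obtain ⟨n, hn⟩ : ∃ n, k + k' = n + 1 := ⟨k + k' - 1, by omega⟩
    obtain ⟨-, Y, f, hex, h0, hadd, hP⟩ := hC'
    have hid : PSaux.ID (R := Γ) C' (k + k') :=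
      ((PSaux.id_of_IdimLE hC.1.2.1).equiv e.symm).mono (by omega)
    rw [hn] at hex h0 hadd hP hid
    obtain ⟨i, p, hip⟩ := PSaux.split_last hex
      (fun i h1 h2 => (addP _ (hP i h1 h2)).2) (hid.memAdd (hadd 0 (by omega)))
    have hY := hP (n+1) (by omega) le_rfl
    have hY' := addP _ hY
    have hinj : Module.Injective Γ (Y (n+2)) := PSaux.injective_of_retract i p hip hY'.2
    have hproj : Module.Projective Γ (Y (n+2)) :=
      @Module.Projective.of_split _ _ _ _ _ _ _ _ hY'.1 i p hip
    have hfin : Module.Finite Γ (Y (n+2)) := by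
      obtain ⟨m, i', p', hip'⟩ := hY
      have : Module.Finite Γ (Y (n+1)) :=
        Module.Finite.of_surjective (M := Fin m → Pii) p'
          (fun x => ⟨i' x, LinearMap.congr_fun hip' x⟩)
      exact Module.Finite.of_surjective p (fun x => ⟨i x, LinearMap.congr_fun hip x⟩)
    have h0' : Y (n+2) = Dreg K Γ := h0
    rw [h0'] at hinj hproj hfin
    have : IsArtinianRing Γ := IsArtinianRing.of_finite K Γ
    exact PSaux.injective_of_trace (PSaux.rho Γ K) hinj (PSaux.rho_mul Γ K)
      (PSaux.rho_bij Γ K)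
end
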